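/- Let N ∈ ℕ and let C^A_{BC} (A,B,C = 1,…,N) be real constants, antisymmetric in the lower indices, such that the N×N matrices C_A with entries (C_A)^B_C = C^B_{AC} satisfy [C_A, C_B] = Σ_C C^C_{AB} C_C. Let γ = (γ_{AB}) be a real symmetric invertible N×N matrix (inverse γ^{AB}) satisfying the invariance condition γ_{AB} C^B_{CD} + γ_{DB} C^B_{CA} = 0. For k ∈ ℝ^N set C(k) := Σ_A k^A C_A, Y(k) := Σ_{j≥0} (−1)^j C(k)^j/(j+1)!, and on the connected component V of 0 of the open set {k : Y(k) invertible and det Y(k) > 0} set X(k) := Y(k)^{−1}, with entries X_A{}^M(k) determined by Σ_M Y^B_M(k) X_A{}^M(k) = δ^B_A, and let X_A := Σ_M X_A{}^M ∂/∂k^M. Then for every k ∈ V: (det X(k))^{−1/2} · Σ_{A,B} γ^{AB} X_A[ X_B[ (det X)^{1/2} ] ](k) = −(1/24) Σ_{A,B,C,D} γ^{AB} C^C_{AD} C^D_{BC}. -/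

import Mathlib

open Matrix

/-- The first-order differential operator `X_A = Σ_M X_A{}^M ∂/∂k^M` acting on functions. -/
noncomputable def vecFieldOp {N : ℕ} (Xe : (Fin N → ℝ) → Fin N → Fin N → ℝ) (A : Fin N)
    (f : (Fin N → ℝ) → ℝ) (k : Fin N → ℝ) : ℝ :=
  ∑ M, Xe k A M * fderiv ℝ f k (Pi.single M 1)

set_option linter.unusedSectionVars false

section PowerSeries

open Filter Topology

variable {m n : Type*} [Fintype m] [DecidableEq m] [Fintype n] [DecidableEq n]

/-- The power series `∑ c j • X ^ j` evaluated at a square matrix. -/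
noncomputable def matPowSum (c : ℕ → ℝ) (X : Matrix n n ℝ) : Matrix n n ℝ :=
  ∑' j, c j • X ^ j

/-- Coefficients dominated by those of the exponential series. -/
def ExpBounded (c : ℕ → ℝ) : Prop := ∀ j, |c j| ≤ (j.factorial : ℝ)⁻¹

lemma ExpBounded.contDiff_tsum {c : ℕ → ℝ} (hc : ExpBounded c) {E : Type*} [NormedRing E]
    [NormedAlgebra ℝ E] [CompleteSpace E] :
    ContDiff ℝ ⊤ fun x : E => ∑' j, c j • x ^ j := by
  have hr : (FormalMultilinearSeries.ofScalars E c).radius = ⊤ := by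
    refine FormalMultilinearSeries.radius_eq_top_of_summable_norm _ fun r => ?_
    refine Summable.of_norm_bounded_eventually_nat
      (g := fun j => (r : ℝ) ^ j / (j.factorial : ℝ)) (Real.summable_pow_div_factorial r) ?_
    filter_upwards [eventually_gt_atTop 0] with j hj
    rw [norm_mul, norm_norm, norm_pow, NNReal.norm_eq, mul_comm, div_eq_mul_inv]
    exact mul_le_mul_of_nonneg_left
      ((FormalMultilinearSeries.ofScalars_norm_le _ _ _ hj).trans (hc j)) (by positivity)
  have h := (FormalMultilinearSeries.ofScalars E c).hasFPowerSeriesOnBall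
    (by rw [hr]; exact ENNReal.zero_lt_top)
  rw [hr] at h
  have h2 := h.analyticOnNhd
  rw [Metric.eball_top] at h2
  have h4 : (fun x : E => ∑' j, c j • x ^ j) = (FormalMultilinearSeries.ofScalars E c).sum := by
    ext1 x
    exact (FormalMultilinearSeries.ofScalars_sum_eq c x).symm
  rw [h4]
  exact h2.contDiff

section Norm

attribute [local instance] Matrix.linftyOpNormedRing Matrix.linftyOpNormedAlgebra

lemma summable_matPowSum {c : ℕ → ℝ} (hc : ExpBounded c) (X : Matrix n n ℝ) :
    Summable fun j => c j • X ^ j := by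
  refine Summable.of_norm_bounded (g := fun j => ‖((j.factorial : ℝ)⁻¹) • X ^ j‖)
    (NormedSpace.norm_expSeries_summable' (𝕂 := ℝ) X) fun j => ?_
  rw [norm_smul, norm_smul, norm_inv, RCLike.norm_natCast]
  exact mul_le_mul_of_nonneg_right (hc j) (norm_nonneg _)

lemma contDiff_matPowSum {c : ℕ → ℝ} (hc : ExpBounded c) :
    ContDiff ℝ ⊤ (matPowSum c : Matrix n n ℝ → Matrix n n ℝ) :=
  hc.contDiff_tsum

end Norm

lemma matPowSum_intertwine {c : ℕ → ℝ} (hc : ExpBounded c) {B : Matrix m m ℝ} {X : Matrix n n ℝ}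
    {J : Matrix m n ℝ} (h : B * J = J * X) : matPowSum c B * J = J * matPowSum c X := by
  have hp : ∀ j, B ^ j * J = J * X ^ j := by
    intro j
    induction j with
    | zero => simp
    | succ j ih => rw [pow_succ, Matrix.mul_assoc, h, ← Matrix.mul_assoc, ih, Matrix.mul_assoc,
        ← pow_succ]
  have h1 := ((summable_matPowSum hc B).hasSum.map
    ((Matrix.addMonoidHomMulRight J : Matrix m m ℝ →+ Matrix m n ℝ))
      (continuous_id.matrix_mul continuous_const))
  have h2 := ((summable_matPowSum hc X).hasSum.map
    ((Matrix.addMonoidHomMulLeft J : Matrix n n ℝ →+ Matrix m n ℝ))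
      (continuous_const.matrix_mul continuous_id))
  refine h1.unique ?_
  convert! h2 using 1
  ext1 j
  simp [hp]

/-- Two functions of matrices, of sizes `n` and `n ⊕ n`, that respect intertwiners: the upper
right block of the second one at `[[Z, D], [0, Z]]` is the derivative of the first one at `Z`
along `D`. -/
lemma hasDerivAt_of_block {g : Matrix n n ℝ → Matrix n n ℝ}
    {G : Matrix (n ⊕ n) (n ⊕ n) ℝ → Matrix (n ⊕ n) (n ⊕ n) ℝ} {Z D : Matrix n n ℝ}
    (hG : ContinuousAt G (fromBlocks Z D 0 Z))
    (hI : ∀ᶠ t : ℝ in 𝓝 0, ∀ (J : Matrix (n ⊕ n) n ℝ) (X : Matrix n n ℝ),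
      X = Z ∨ X = Z + t • D → fromBlocks Z D 0 (Z + t • D) * J = J * X →
      G (fromBlocks Z D 0 (Z + t • D)) * J = J * g X) (i j : n) :
    HasDerivAt (fun t : ℝ => g (Z + t • D) i j) ((G (fromBlocks Z D 0 Z)).toBlocks₁₂ i j) 0 := by
  rw [hasDerivAt_iff_tendsto_slope_zero]
  have hB : Tendsto (fun t : ℝ => fromBlocks Z D 0 (Z + t • D)) (𝓝 0) (𝓝 (fromBlocks Z D 0 Z)) := by
    have : Continuous fun t : ℝ => fromBlocks Z D 0 (Z + t • D) := by fun_prop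
    simpa using this.tendsto 0
  have h1 : Tendsto (fun t : ℝ => (G (fromBlocks Z D 0 (Z + t • D))).toBlocks₁₂ i j) (𝓝[≠] 0)
      (𝓝 ((G (fromBlocks Z D 0 Z)).toBlocks₁₂ i j)) := by
    have h2 := (hG.tendsto.comp hB).mono_left (nhdsWithin_le_nhds (s := {(0 : ℝ)}ᶜ))
    exact ((continuous_id.matrix_elem (Sum.inl i) (Sum.inr j)).tendsto _).comp h2
  refine h1.congr' ?_
  filter_upwards [nhdsWithin_le_nhds hI, self_mem_nhdsWithin] with t ht h0
  have h0 : t ≠ 0 := h0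
  have e1 := ht (fromRows 1 0) Z (Or.inl rfl) (by
    rw [fromBlocks_mul_fromRows, fromRows_mul]; simp)
  have e2 := ht (fromRows (t⁻¹ • 1) 1) (Z + t • D) (Or.inr rfl) (by
    rw [fromBlocks_mul_fromRows, fromRows_mul]; simp [smul_smul, h0])
  rw [← fromBlocks_toBlocks (G (fromBlocks Z D 0 (Z + t • D))), fromBlocks_mul_fromRows,
    fromRows_mul] at e1 e2
  have e3 := (fromRows_inj e1).1
  have e4 := (fromRows_inj e2).1
  simp only [Matrix.mul_one, Matrix.mul_zero, add_zero, Matrix.one_mul, Matrix.mul_smul,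
    Matrix.smul_mul] at e3 e4
  rw [e3] at e4
  have e5 := congrFun (congrFun e4 i) j
  simp only [Matrix.add_apply, Matrix.smul_apply, smul_eq_mul] at e5
  rw [zero_add, zero_smul, add_zero, smul_eq_mul]
  linarith

lemma matPowSum_block_left {c : ℕ → ℝ} (hc : ExpBounded c) (X D W : Matrix n n ℝ) :
    matPowSum c (fromBlocks X D 0 W) *
      fromRows (1 : Matrix n n ℝ) (0 : Matrix n n ℝ) =
      fromRows (1 : Matrix n n ℝ) (0 : Matrix n n ℝ) * matPowSum c X :=
  matPowSum_intertwine hc (by rw [fromBlocks_mul_fromRows, fromRows_mul]; simp)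

lemma matPowSum_block_right {c : ℕ → ℝ} (hc : ExpBounded c) (X D W : Matrix n n ℝ) :
    matPowSum c W * fromCols (0 : Matrix n n ℝ) (1 : Matrix n n ℝ) =
      fromCols (0 : Matrix n n ℝ) (1 : Matrix n n ℝ) * matPowSum c (fromBlocks X D 0 W) :=
  matPowSum_intertwine hc (by rw [fromCols_mul_fromBlocks, mul_fromCols]; simp)

lemma matPowSum_block {c : ℕ → ℝ} (hc : ExpBounded c) (X D W : Matrix n n ℝ) :
    matPowSum c (fromBlocks X D 0 W) = fromBlocks (matPowSum c X)
      (matPowSum c (fromBlocks X D 0 W)).toBlocks₁₂ 0 (matPowSum c W) := by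
  have e1 := matPowSum_block_left hc X D W
  have e2 := matPowSum_block_right hc X D W
  rw [← fromBlocks_toBlocks (matPowSum c (fromBlocks X D 0 W))] at e1 e2
  rw [fromBlocks_mul_fromRows, fromRows_mul] at e1
  rw [fromCols_mul_fromBlocks, mul_fromCols] at e2
  have e3 := fromRows_inj e1
  have e4 := fromCols_inj e2
  simp only [Matrix.mul_one, Matrix.mul_zero, add_zero, Matrix.one_mul, Matrix.zero_mul,
    zero_add] at e3 e4
  conv_lhs => rw [← fromBlocks_toBlocks (matPowSum c (fromBlocks X D 0 W)), e3.1, e3.2, ← e4.2]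

/-- Against a matrix commuting with `Z`, the derivative of a power series at `Z` is the
power series of the formal derivative. -/
lemma trace_mul_matPowSum_block {c : ℕ → ℝ} (hc : ExpBounded c)
    (hc' : ExpBounded fun j => ((j : ℝ) + 1) * c (j + 1)) {Z D G : Matrix n n ℝ}
    (hG : Commute G Z) :
    (G * (matPowSum c (fromBlocks Z D 0 Z)).toBlocks₁₂).trace =
      (G * matPowSum (fun j => ((j : ℝ) + 1) * c (j + 1)) Z * D).trace := by
  have hp : ∀ j : ℕ, fromBlocks Z D 0 Z ^ j =
      fromBlocks (Z ^ j) (fromBlocks Z D 0 Z ^ j).toBlocks₁₂ 0 (Z ^ j) := by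
    intro j
    induction j with
    | zero => simp [← fromBlocks_one]
    | succ j ih =>
      rw [pow_succ, ih, fromBlocks_multiply, toBlocks_fromBlocks₁₂]
      simp [pow_succ]
  have ht : ∀ j : ℕ, ∀ G : Matrix n n ℝ, Commute G Z →
      (G * (fromBlocks Z D 0 Z ^ (j + 1)).toBlocks₁₂).trace =
      ((j : ℝ) + 1) * (G * Z ^ j * D).trace := by
    intro j
    induction j with
    | zero => intro G _; simp
    | succ j ih =>
      intro G hG
      rw [pow_succ', hp (j + 1), fromBlocks_multiply, toBlocks_fromBlocks₁₂, Matrix.mul_add,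
        trace_add, ← Matrix.mul_assoc, ih (G * Z) (hG.mul_left (Commute.refl Z)),
        Matrix.mul_assoc G Z, ← pow_succ', ← Matrix.mul_assoc, Matrix.trace_mul_comm (G * D),
        ← Matrix.mul_assoc, (hG.pow_right (j + 1)).eq]
      push_cast
      ring
  let φ : Matrix (n ⊕ n) (n ⊕ n) ℝ →+ ℝ :=
    { toFun := fun M => (G * M.toBlocks₁₂).trace
      map_zero' := by
        have : (0 : Matrix (n ⊕ n) (n ⊕ n) ℝ).toBlocks₁₂ = 0 := rfl
        simp [this]
      map_add' := fun A B => by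
        have : (A + B).toBlocks₁₂ = A.toBlocks₁₂ + B.toBlocks₁₂ := rfl
        rw [this, Matrix.mul_add, trace_add] }
  let ψ : Matrix n n ℝ →+ ℝ :=
    { toFun := fun M => (G * M * D).trace
      map_zero' := by simp
      map_add' := fun A B => by rw [Matrix.mul_add, Matrix.add_mul, trace_add] }
  have hφ : Continuous φ := by
    change Continuous fun M : Matrix (n ⊕ n) (n ⊕ n) ℝ => (G * M.toBlocks₁₂).trace
    refine Continuous.matrix_trace (continuous_const.matrix_mul ?_)
    exact continuous_matrix fun i j => continuous_id.matrix_elem _ _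
  have hψ : Continuous ψ := by
    change Continuous fun M : Matrix n n ℝ => (G * M * D).trace
    fun_prop
  have h1 := (summable_matPowSum hc (fromBlocks Z D 0 Z)).hasSum.map φ hφ
  have h2 := (summable_matPowSum hc' Z).hasSum.map ψ hψ
  rw [← hasSum_nat_add_iff' 1] at h1
  have h3 : HasSum (fun j : ℕ => ((j : ℝ) + 1) * c (j + 1) * (G * Z ^ j * D).trace)
      (G * (matPowSum c (fromBlocks Z D 0 Z)).toBlocks₁₂).trace := by
    convert! h1 using 1
    · ext1 j
      have := ht j G hG
      simp only [Function.comp_apply]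
      change _ = (G * (c (j + 1) • (fromBlocks Z D 0 Z ^ (j + 1)).toBlocks₁₂)).trace
      rw [Matrix.mul_smul, trace_smul, this, smul_eq_mul]
      ring
    · have h0 : φ (c 0 • (1 : Matrix (n ⊕ n) (n ⊕ n) ℝ)) = 0 := by
        change (G * (c 0 • (1 : Matrix (n ⊕ n) (n ⊕ n) ℝ).toBlocks₁₂)).trace = 0
        simp [← fromBlocks_one]
      simp only [Finset.range_one, Finset.sum_singleton, Function.comp_apply, pow_zero, h0,
        sub_zero]
      rfl
  have h4 : HasSum (fun j : ℕ => ((j : ℝ) + 1) * c (j + 1) * (G * Z ^ j * D).trace)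
      (G * matPowSum (fun j => ((j : ℝ) + 1) * c (j + 1)) Z * D).trace := by
    convert! h2 using 1
    ext1 j
    simp [ψ]
  exact h3.unique h4

/-- `(1 - exp (-X)) / X` as an entire function of a square matrix. -/
noncomputable def matY (X : Matrix n n ℝ) : Matrix n n ℝ :=
  matPowSum (fun j => (-1 : ℝ) ^ j / ((j + 1).factorial : ℝ)) X

/-- The derivative of the scalar function `(1 - exp (-x)) / x`, evaluated at a square matrix. -/
noncomputable def matDY (X : Matrix n n ℝ) : Matrix n n ℝ :=
  matPowSum (fun j => ((j : ℝ) + 1) * ((-1 : ℝ) ^ (j + 1) / ((j + 1 + 1).factorial : ℝ))) X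

/-- `coth (X / 2) / 2 - 1 / X` as a function of a square matrix. -/
noncomputable def matH (X : Matrix n n ℝ) : Matrix n n ℝ :=
  matDY X * (matY X)⁻¹ + (1 / 2 : ℝ) • 1

lemma expBounded_matY : ExpBounded fun j => (-1 : ℝ) ^ j / ((j + 1).factorial : ℝ) := by
  intro j
  rw [abs_div, abs_pow, abs_neg, abs_one, one_pow, Nat.abs_cast, one_div]
  exact inv_anti₀ (by positivity) (by exact_mod_cast Nat.factorial_le (Nat.le_succ j))

lemma expBounded_matDY : ExpBounded fun j =>
    ((j : ℝ) + 1) * ((-1 : ℝ) ^ (j + 1) / ((j + 1 + 1).factorial : ℝ)) := by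
  intro j
  rw [abs_mul, abs_div, abs_pow, abs_neg, abs_one, one_pow, Nat.abs_cast,
    abs_of_nonneg (by positivity),
    Nat.factorial_succ (j + 1), Nat.factorial_succ j, inv_eq_one_div, mul_one_div,
    div_le_div_iff₀ (by positivity) (by positivity)]
  push_cast
  have : (0 : ℝ) < j.factorial := by positivity
  have hj : (0 : ℝ) ≤ j := by positivity
  nlinarith [mul_nonneg hj this.le, mul_nonneg hj (mul_nonneg hj this.le)]

section Norm

attribute [local instance] Matrix.linftyOpNormedRing Matrix.linftyOpNormedAlgebra

lemma hasSum_exp_neg (X : Matrix n n ℝ) :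
    HasSum (fun j : ℕ => ((-1 : ℝ) ^ j / (j.factorial : ℝ)) • X ^ j) (NormedSpace.exp (-X)) := by
  have h := NormedSpace.exp_series_hasSum_exp' (𝕂 := ℝ) (-X)
  convert! h using 1
  ext1 j
  rw [neg_pow X j, ← smul_one_mul ((-1 : ℝ) ^ j / _)]
  have : ((-1 : Matrix n n ℝ)) ^ j = ((-1 : ℝ) ^ j) • 1 := by
    rw [← neg_one_smul ℝ (1 : Matrix n n ℝ), smul_pow, one_pow]
  rw [this, smul_mul_assoc, smul_mul_assoc, smul_smul, one_mul]
  congr 1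
  ring

lemma mul_matY (X : Matrix n n ℝ) : X * matY X = 1 - NormedSpace.exp (-X) := by
  have h1 := ((summable_matPowSum expBounded_matY X).hasSum).mul_left X
  have h2 := hasSum_exp_neg X
  rw [← hasSum_nat_add_iff' 1] at h2
  have h3 := h2.neg
  have h4 : X * matY X = -(NormedSpace.exp (-X) -
      ∑ i ∈ Finset.range 1, ((-1 : ℝ) ^ i / (i.factorial : ℝ)) • X ^ i) := by
    refine h1.unique ?_
    convert! h3 using 1
    ext1 j
    rw [mul_smul_comm, ← pow_succ', ← neg_smul]
    congr 1
    ring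
  rw [h4]
  simp

lemma mul_matDY (X : Matrix n n ℝ) : X * matDY X + matY X = NormedSpace.exp (-X) := by
  have h1 := ((summable_matPowSum expBounded_matDY X).hasSum).mul_left X
  have h2 := (summable_matPowSum expBounded_matY X).hasSum
  have h3 := hasSum_exp_neg X
  rw [← hasSum_nat_add_iff' 1] at h2 h3
  have h4 := h1.add h2
  have h5 := h4.unique (by
    convert! h3 using 1
    ext1 j
    rw [mul_smul_comm, ← pow_succ', ← add_smul]
    congr 1
    rw [Nat.factorial_succ (j + 1)]
    push_cast
    field_simp)
  simp only [Finset.range_one, Finset.sum_singleton, pow_zero, zero_add, Nat.factorial_one,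
    Nat.factorial_zero] at h5
  have h6 : X * matDY X + (matY X - ((1 : ℝ) / (1 : ℕ)) • 1) =
    NormedSpace.exp (-X) - ((1 : ℝ) / (1 : ℕ)) • 1 := h5
  rw [← add_sub_assoc] at h6
  exact sub_left_injective h6

lemma continuous_matPowSum {c : ℕ → ℝ} (hc : ExpBounded c) :
    Continuous (matPowSum c : Matrix n n ℝ → Matrix n n ℝ) :=
  (contDiff_matPowSum hc).continuous

lemma contDiffAt_matH {X : Matrix n n ℝ} (hX : IsUnit (matY X)) :
    ContDiffAt ℝ ⊤ (matH : Matrix n n ℝ → Matrix n n ℝ) X := by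
  obtain ⟨u, hu⟩ := hX
  have h1 : ContDiffAt ℝ ⊤ (fun X : Matrix n n ℝ => (matY X)⁻¹) X := by
    have h2 := contDiffAt_ringInverse ℝ (n := ⊤) u
    rw [hu] at h2
    have hc : ContDiffAt ℝ ⊤ (matY : Matrix n n ℝ → Matrix n n ℝ) X :=
      (contDiff_matPowSum expBounded_matY).contDiffAt
    have h3 := h2.comp X hc
    refine h3.congr_of_eventuallyEq (Eventually.of_forall fun W => ?_)
    exact nonsing_inv_eq_ringInverse _
  have h4 : ContDiffAt ℝ ⊤ (matDY : Matrix n n ℝ → Matrix n n ℝ) X :=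
    (contDiff_matPowSum expBounded_matDY).contDiffAt
  exact (h4.mul h1).add contDiffAt_const

lemma continuousAt_matH {X : Matrix n n ℝ} (hX : IsUnit (matY X)) :
    ContinuousAt (matH : Matrix n n ℝ → Matrix n n ℝ) X :=
  (contDiffAt_matH hX).continuousAt

end Norm

lemma matH_intertwine {B : Matrix m m ℝ} {X : Matrix n n ℝ} {J : Matrix m n ℝ}
    (hB : IsUnit (matY B)) (hX : IsUnit (matY X)) (h : B * J = J * X) :
    matH B * J = J * matH X := by
  have e1 : matY B * J = J * matY X := matPowSum_intertwine expBounded_matY h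
  have e2 : matDY B * J = J * matDY X := matPowSum_intertwine expBounded_matDY h
  have e3 : (matY B)⁻¹ * J = J * (matY X)⁻¹ := by
    have hB' := (isUnit_iff_isUnit_det _).1 hB
    have hX' := (isUnit_iff_isUnit_det _).1 hX
    calc (matY B)⁻¹ * J = (matY B)⁻¹ * (J * matY X) * (matY X)⁻¹ := by
          rw [Matrix.mul_assoc, Matrix.mul_assoc J, mul_nonsing_inv _ hX', Matrix.mul_one]
      _ = J * (matY X)⁻¹ := by
          rw [← e1, ← Matrix.mul_assoc, nonsing_inv_mul _ hB', Matrix.one_mul]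
  rw [matH, matH, Matrix.add_mul, Matrix.mul_add, Matrix.mul_assoc, e3, ← Matrix.mul_assoc, e2,
    Matrix.mul_assoc]
  simp

lemma isUnit_matY_block {X D W : Matrix n n ℝ} (hX : IsUnit (matY X)) (hW : IsUnit (matY W)) :
    IsUnit (matY (fromBlocks X D 0 W)) := by
  rw [isUnit_iff_isUnit_det] at *
  rw [matY, matPowSum_block expBounded_matY, det_fromBlocks_zero₂₁]
  exact hX.mul hW

/-- The divided difference of `matH`. -/
noncomputable def matHDiff (X D W : Matrix n n ℝ) : Matrix n n ℝ :=
  (matH (fromBlocks X D 0 W)).toBlocks₁₂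

lemma matH_block {X D W : Matrix n n ℝ} (hX : IsUnit (matY X)) (hW : IsUnit (matY W)) :
    matH (fromBlocks X D 0 W) = fromBlocks (matH X) (matHDiff X D W) 0 (matH W) := by
  have hB := isUnit_matY_block (D := D) hX hW
  have e1 : matH (fromBlocks X D 0 W) * fromRows (1 : Matrix n n ℝ) (0 : Matrix n n ℝ) =
      fromRows (1 : Matrix n n ℝ) (0 : Matrix n n ℝ) * matH X :=
    matH_intertwine hB hX (by rw [fromBlocks_mul_fromRows, fromRows_mul]; simp)
  have e2 : matH W * fromCols (0 : Matrix n n ℝ) (1 : Matrix n n ℝ) =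
      fromCols (0 : Matrix n n ℝ) (1 : Matrix n n ℝ) * matH (fromBlocks X D 0 W) :=
    matH_intertwine hW hB (by rw [fromCols_mul_fromBlocks, mul_fromCols]; simp)
  rw [← fromBlocks_toBlocks (matH (fromBlocks X D 0 W))] at e1 e2
  rw [fromBlocks_mul_fromRows, fromRows_mul] at e1
  rw [fromCols_mul_fromBlocks, mul_fromCols] at e2
  have e3 := fromRows_inj e1
  have e4 := fromCols_inj e2
  simp only [Matrix.mul_one, Matrix.mul_zero, add_zero, Matrix.one_mul, Matrix.zero_mul,
    zero_add] at e3 e4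
  conv_lhs => rw [← fromBlocks_toBlocks (matH (fromBlocks X D 0 W)), e3.1, e3.2, ← e4.2]
  rfl

lemma matHDiff_commutator {X D W : Matrix n n ℝ} (hX : IsUnit (matY X)) (hW : IsUnit (matY W)) :
    X * matHDiff X D W - matHDiff X D W * W = matH X * D - D * matH W := by
  have hB := isUnit_matY_block (D := D) hX hW
  have h := matH_intertwine hB hB rfl
  rw [matH_block hX hW, fromBlocks_multiply, fromBlocks_multiply, fromBlocks_inj] at h
  linear_combination (norm := abel) -h.2.1

lemma matHDiff_lie {Z K : Matrix n n ℝ} (hZ : IsUnit (matY Z)) :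
    matHDiff Z (Z * K - K * Z) Z = matH Z * K - K * matH Z := by
  have hB := isUnit_matY_block (D := Z * K - K * Z) hZ hZ
  have e1 : matH (fromBlocks Z (Z * K - K * Z) 0 Z) *
      fromRows (-K : Matrix n n ℝ) (1 : Matrix n n ℝ) =
      fromRows (-K : Matrix n n ℝ) (1 : Matrix n n ℝ) * matH Z :=
    matH_intertwine hB hZ (by
      rw [fromBlocks_mul_fromRows, fromRows_mul]; simp; congr 1; abel)
  rw [matH_block hZ hZ, fromBlocks_mul_fromRows, fromRows_mul] at e1
  have e3 := (fromRows_inj e1).1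
  simp only [Matrix.mul_one, Matrix.mul_neg, Matrix.neg_mul] at e3
  linear_combination (norm := abel) e3

lemma matH_eq {X : Matrix n n ℝ} (hX : IsUnit X) (hY : IsUnit (matY X)) :
    matH X = (1 - NormedSpace.exp (-X))⁻¹ - (1 / 2 : ℝ) • 1 - X⁻¹ := by
  have hX' := (isUnit_iff_isUnit_det _).1 hX
  have hY' := (isUnit_iff_isUnit_det _).1 hY
  have hc : matY X * X = X * matY X := matPowSum_intertwine expBounded_matY rfl
  have e1 : matDY X = X⁻¹ * (1 - X * matY X - matY X) := by
    rw [mul_matY, sub_sub_cancel, ← mul_matDY, add_sub_cancel_right, ← Matrix.mul_assoc,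
      nonsing_inv_mul _ hX', Matrix.one_mul]
  have e2 : X⁻¹ * (1 - X * matY X - matY X) * (matY X)⁻¹ = X⁻¹ * (matY X)⁻¹ - 1 - X⁻¹ := by
    rw [Matrix.mul_sub, Matrix.mul_sub, ← Matrix.mul_assoc X⁻¹ X, nonsing_inv_mul _ hX',
      Matrix.sub_mul, Matrix.sub_mul, Matrix.one_mul, Matrix.mul_one, mul_nonsing_inv _ hY',
      Matrix.mul_assoc X⁻¹, mul_nonsing_inv _ hY', Matrix.mul_one]
  rw [matH, e1, e2, ← mul_matY, ← hc, Matrix.mul_inv_rev]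
  module

lemma matH_neg {X : Matrix n n ℝ} (hX : IsUnit X) (hY : IsUnit (matY X))
    (hY' : IsUnit (matY (-X))) : matH (-X) = -matH X := by
  have hu : IsUnit (1 - NormedSpace.exp (-X)).det := by
    rw [← isUnit_iff_isUnit_det, ← mul_matY]
    exact hX.mul hY
  have h1 : (1 - NormedSpace.exp X) * -(NormedSpace.exp (-X) * (1 - NormedSpace.exp (-X))⁻¹) =
      1 := by
    have h2 : (1 - NormedSpace.exp X) * -NormedSpace.exp (-X) = 1 - NormedSpace.exp (-X) := by
      have h3 : NormedSpace.exp X * NormedSpace.exp (-X) = 1 := by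
        rw [← Matrix.exp_add_of_commute _ _ (Commute.refl X).neg_right, add_neg_cancel,
          NormedSpace.exp_zero]
      rw [Matrix.mul_neg, Matrix.sub_mul, h3, Matrix.one_mul]
      abel
    rw [← Matrix.neg_mul, ← Matrix.mul_assoc, h2, mul_nonsing_inv _ hu]
  have h4 := mul_nonsing_inv _ hu
  rw [Matrix.sub_mul, Matrix.one_mul] at h4
  have h5 : -X⁻¹ = (-X)⁻¹ := (inv_eq_right_inv (by
    rw [Matrix.neg_mul, Matrix.mul_neg, neg_neg,
      mul_nonsing_inv _ ((isUnit_iff_isUnit_det _).1 hX)])).symm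
  rw [matH_eq hX.neg hY', matH_eq hX hY, neg_neg, inv_eq_right_inv h1, ← h5,
    eq_sub_of_add_eq (sub_eq_iff_eq_add'.1 h4).symm]
  module

/-- The contraction of two tensors `f` and `g` of rank three along three matrices. -/
noncomputable def triForm (f g : n × n × n → ℝ) (U V W : Matrix n n ℝ) : ℝ :=
  ∑ p, ∑ q, f p * g q * (U p.1 q.1 * V p.2.1 q.2.1 * W p.2.2 q.2.2)

section Norm

attribute [local instance] Matrix.linftyOpNormedRing Matrix.linftyOpNormedAlgebra

lemma hasDerivAt_exp_smul_mul (Z U : Matrix n n ℝ) (t : ℝ) (i j : n) :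
    HasDerivAt (fun t : ℝ => (NormedSpace.exp (t • Z) * U) i j)
      ((Z * (NormedSpace.exp (t • Z) * U)) i j) t := by
  have h := (hasDerivAt_exp_smul_const' (𝕂 := ℝ) Z t).mul_const U
  rw [Matrix.mul_assoc] at h
  exact hasDerivAt_pi.1 (hasDerivAt_pi.1 h i) j

end Norm

lemma triForm_exp {f g : n × n × n → ℝ} {Z₁ Z₂ Z₃ : Matrix n n ℝ}
    (hinv : ∀ U V W, triForm f g (Z₁ * U) V W + triForm f g U (Z₂ * V) W +
      triForm f g U V (Z₃ * W) = 0) (U V W : Matrix n n ℝ) (t : ℝ) :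
    triForm f g (NormedSpace.exp (t • Z₁) * U) (NormedSpace.exp (t • Z₂) * V)
      (NormedSpace.exp (t • Z₃) * W) = triForm f g U V W := by
  have hd : ∀ t : ℝ, HasDerivAt (fun t : ℝ => triForm f g (NormedSpace.exp (t • Z₁) * U)
      (NormedSpace.exp (t • Z₂) * V) (NormedSpace.exp (t • Z₃) * W)) 0 t := by
    intro t
    rw [← hinv (NormedSpace.exp (t • Z₁) * U) (NormedSpace.exp (t • Z₂) * V)
      (NormedSpace.exp (t • Z₃) * W)]
    unfold triForm
    rw [← Finset.sum_add_distrib, ← Finset.sum_add_distrib]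
    refine HasDerivAt.fun_sum fun p _ => ?_
    rw [← Finset.sum_add_distrib, ← Finset.sum_add_distrib]
    refine HasDerivAt.fun_sum fun q _ => ?_
    rw [← mul_add, ← mul_add]
    refine HasDerivAt.const_mul _ ?_
    refine (((hasDerivAt_exp_smul_mul Z₁ U t _ _).fun_mul
      (hasDerivAt_exp_smul_mul Z₂ V t _ _)).fun_mul
        (hasDerivAt_exp_smul_mul Z₃ W t _ _)).congr_deriv ?_
    ring
  have h := is_const_of_deriv_eq_zero (fun t => (hd t).differentiableAt)
    (fun t => (hd t).deriv) t 0
  simpa using h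

lemma triForm_matH {f g : n × n × n → ℝ} {Z₁ Z₂ Z₃ : Matrix n n ℝ}
    (hinv : ∀ U V W, triForm f g (Z₁ * U) V W + triForm f g U (Z₂ * V) W +
      triForm f g U V (Z₃ * W) = 0)
    (h₁ : IsUnit Z₁) (h₂ : IsUnit Z₂) (h₃ : IsUnit Z₃)
    (hY₁ : IsUnit (matY Z₁)) (hY₂ : IsUnit (matY Z₂)) (hY₃ : IsUnit (matY Z₃)) :
    triForm f g (matH Z₁) (matH Z₂) 1 + triForm f g (matH Z₁) 1 (matH Z₃) +
      triForm f g 1 (matH Z₂) (matH Z₃) +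
      (triForm f g (matH Z₁) Z₂⁻¹ 1 + triForm f g Z₁⁻¹ (matH Z₂) 1) +
      (triForm f g (matH Z₁) 1 Z₃⁻¹ + triForm f g Z₁⁻¹ 1 (matH Z₃)) +
      (triForm f g 1 (matH Z₂) Z₃⁻¹ + triForm f g 1 Z₂⁻¹ (matH Z₃)) =
      -(1 / 4) * triForm f g 1 1 1 := by
  have hD : ∀ {X : Matrix n n ℝ}, IsUnit X → IsUnit (matY X) →
      NormedSpace.exp ((-1 : ℝ) • X) * (1 - NormedSpace.exp (-X))⁻¹ =
        (1 - NormedSpace.exp (-X))⁻¹ - 1 := by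
    intro X hX hY
    have hu : IsUnit (1 - NormedSpace.exp (-X)).det := by
      rw [← isUnit_iff_isUnit_det, ← mul_matY]
      exact hX.mul hY
    have h := mul_nonsing_inv _ hu
    rw [Matrix.sub_mul, Matrix.one_mul] at h
    rw [neg_one_smul]
    exact eq_sub_of_add_eq (sub_eq_iff_eq_add'.1 h).symm
  have e1 := triForm_exp hinv (1 - NormedSpace.exp (-Z₁))⁻¹ (1 - NormedSpace.exp (-Z₂))⁻¹
    (1 - NormedSpace.exp (-Z₃))⁻¹ (-1)
  rw [hD h₁ hY₁, hD h₂ hY₂, hD h₃ hY₃] at e1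
  have e2 := hinv Z₁⁻¹ Z₂⁻¹ Z₃⁻¹
  rw [mul_nonsing_inv _ ((isUnit_iff_isUnit_det _).1 h₁),
    mul_nonsing_inv _ ((isUnit_iff_isUnit_det _).1 h₂),
    mul_nonsing_inv _ ((isUnit_iff_isUnit_det _).1 h₃)] at e2
  rw [matH_eq h₁ hY₁, matH_eq h₂ hY₂, matH_eq h₃ hY₃]
  generalize (1 - NormedSpace.exp (-Z₁))⁻¹ = D₁ at *
  generalize (1 - NormedSpace.exp (-Z₂))⁻¹ = D₂ at *
  generalize (1 - NormedSpace.exp (-Z₃))⁻¹ = D₃ at *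
  rw [← sub_eq_zero] at e1 ⊢
  refine Eq.trans ?_ (show -(triForm f g (D₁ - 1) (D₂ - 1) (D₃ - 1) - triForm f g D₁ D₂ D₃) -
    (triForm f g 1 Z₂⁻¹ Z₃⁻¹ + triForm f g Z₁⁻¹ 1 Z₃⁻¹ + triForm f g Z₁⁻¹ Z₂⁻¹ 1) = 0 by
      rw [e1, e2]; simp)
  simp only [triForm, Finset.mul_sum, ← Finset.sum_add_distrib, ← Finset.sum_sub_distrib,
    ← Finset.sum_neg_distrib]
  refine Finset.sum_congr rfl fun p _ => Finset.sum_congr rfl fun q _ => ?_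
  simp only [Matrix.sub_apply, Matrix.smul_apply, smul_eq_mul]
  ring

/-- The matrix of the adjoint action of the `a`-th basis vector, for structure constants `C`. -/
def adMat (C : n → n → n → ℝ) (a : n) : Matrix n n ℝ :=
  of fun b c => C b a c

/-- The matrix of the adjoint action of the vector `k`. -/
noncomputable def adSum (C : n → n → n → ℝ) (k : n → ℝ) : Matrix n n ℝ :=
  ∑ a, k a • adMat C a

/-- `C` are the structure constants of a Lie algebra and `γ` is the Gram matrix of an invariant
nondegenerate symmetric bilinear form. -/
structure IsQuadraticLie (C : n → n → n → ℝ) (γ : Matrix n n ℝ) : Prop where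
  antisymm : ∀ a b c, C a b c = -C a c b
  jacobi : ∀ a b, adMat C a * adMat C b - adMat C b * adMat C a = ∑ c, C c a b • adMat C c
  symm : γᵀ = γ
  isUnit : IsUnit γ
  invariant : ∀ a b c, ∑ d, (γ a d * C d b c + γ c d * C d b a) = 0

/-- The structure constants with the first index lowered. -/
noncomputable def lowTensor (C : n → n → n → ℝ) (γ : Matrix n n ℝ) (p : n × n × n) : ℝ :=
  ∑ d, γ p.1 d * C d p.2.1 p.2.2

/-- The structure constants with the last two indices raised. -/
noncomputable def upTensor (C : n → n → n → ℝ) (γ : Matrix n n ℝ) (p : n × n × n) : ℝ :=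
  ∑ b, ∑ c, γ⁻¹ p.2.1 b * γ⁻¹ p.2.2 c * C p.1 b c

lemma triForm_mul_left (f g : n × n × n → ℝ) (Z U V W : Matrix n n ℝ) :
    triForm f g (Z * U) V W =
      triForm (fun p => ∑ a, f (a, p.2.1, p.2.2) * Z a p.1) g U V W := by
  unfold triForm
  rw [Finset.sum_comm]
  conv_rhs => rw [Finset.sum_comm]
  refine Finset.sum_congr rfl fun q _ => ?_
  simp only [Fintype.sum_prod_type, Matrix.mul_apply, Finset.sum_mul, Finset.mul_sum]
  rw [Finset.sum_comm]
  conv_rhs => rw [Finset.sum_comm]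
  refine Finset.sum_congr rfl fun b _ => ?_
  rw [Finset.sum_comm]
  conv_rhs => rw [Finset.sum_comm]
  refine Finset.sum_congr rfl fun c _ => ?_
  rw [Finset.sum_comm]
  exact Finset.sum_congr rfl fun e _ => Finset.sum_congr rfl fun a _ => by ring

lemma triForm_mul_middle (f g : n × n × n → ℝ) (Z U V W : Matrix n n ℝ) :
    triForm f g U (Z * V) W =
      triForm (fun p => ∑ b, f (p.1, b, p.2.2) * Z b p.2.1) g U V W := by
  unfold triForm
  rw [Finset.sum_comm]
  conv_rhs => rw [Finset.sum_comm]
  refine Finset.sum_congr rfl fun q _ => ?_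
  simp only [Fintype.sum_prod_type, Matrix.mul_apply, Finset.sum_mul, Finset.mul_sum]
  refine Finset.sum_congr rfl fun a _ => ?_
  rw [Finset.sum_comm]
  conv_rhs => rw [Finset.sum_comm]
  refine Finset.sum_congr rfl fun c _ => ?_
  rw [Finset.sum_comm]
  exact Finset.sum_congr rfl fun e _ => Finset.sum_congr rfl fun b _ => by ring

lemma triForm_mul_right (f g : n × n × n → ℝ) (Z U V W : Matrix n n ℝ) :
    triForm f g U V (Z * W) =
      triForm (fun p => ∑ c, f (p.1, p.2.1, c) * Z c p.2.2) g U V W := by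
  unfold triForm
  rw [Finset.sum_comm]
  conv_rhs => rw [Finset.sum_comm]
  refine Finset.sum_congr rfl fun q _ => ?_
  simp only [Fintype.sum_prod_type, Matrix.mul_apply, Finset.sum_mul, Finset.mul_sum]
  refine Finset.sum_congr rfl fun a _ => Finset.sum_congr rfl fun b _ => ?_
  rw [Finset.sum_comm]
  exact Finset.sum_congr rfl fun e _ => Finset.sum_congr rfl fun c _ => by ring

lemma triForm_swap_left {f g : n × n × n → ℝ} (hf : ∀ a b c, f (b, a, c) = -f (a, b, c))
    (hg : ∀ a b c, g (b, a, c) = -g (a, b, c)) (U V W : Matrix n n ℝ) :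
    triForm f g V U W = triForm f g U V W := by
  let e : n × n × n ≃ n × n × n :=
    ⟨fun p => (p.2.1, p.1, p.2.2), fun p => (p.2.1, p.1, p.2.2), fun _ => rfl, fun _ => rfl⟩
  unfold triForm
  rw [← e.sum_comp]
  refine Finset.sum_congr rfl fun p _ => ?_
  rw [← e.sum_comp]
  refine Finset.sum_congr rfl fun q _ => ?_
  change f (p.2.1, p.1, p.2.2) * g (q.2.1, q.1, q.2.2) * _ = _
  rw [hf, hg]
  change -f p * -g q * (V p.2.1 q.2.1 * U p.1 q.1 * W p.2.2 q.2.2) = _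
  ring

lemma triForm_swap_right {f g : n × n × n → ℝ} (hf : ∀ a b c, f (a, c, b) = -f (a, b, c))
    (hg : ∀ a b c, g (a, c, b) = -g (a, b, c)) (U V W : Matrix n n ℝ) :
    triForm f g U W V = triForm f g U V W := by
  let e : n × n × n ≃ n × n × n :=
    ⟨fun p => (p.1, p.2.2, p.2.1), fun p => (p.1, p.2.2, p.2.1), fun _ => rfl, fun _ => rfl⟩
  unfold triForm
  rw [← e.sum_comp]
  refine Finset.sum_congr rfl fun p _ => ?_
  rw [← e.sum_comp]
  refine Finset.sum_congr rfl fun q _ => ?_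
  change f (p.1, p.2.2, p.2.1) * g (q.1, q.2.2, q.2.1) * _ = _
  rw [hf, hg]
  change -f p * -g q * (U p.1 q.1 * W p.2.2 q.2.2 * V p.2.1 q.2.1) = _
  ring

namespace IsQuadraticLie

variable {C : n → n → n → ℝ} {γ : Matrix n n ℝ}

lemma isUnit_det (h : IsQuadraticLie C γ) : IsUnit γ.det := (isUnit_iff_isUnit_det _).1 h.isUnit

lemma inv_transpose (h : IsQuadraticLie C γ) : (γ⁻¹)ᵀ = γ⁻¹ := by
  rw [transpose_nonsing_inv, h.symm]

lemma lowTensor_swap_right (h : IsQuadraticLie C γ) (a b c : n) :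
    lowTensor C γ (a, c, b) = -lowTensor C γ (a, b, c) := by
  simp only [lowTensor, ← Finset.sum_neg_distrib]
  exact Finset.sum_congr rfl fun d _ => by rw [h.antisymm d c b]; ring

lemma lowTensor_swap_outer (h : IsQuadraticLie C γ) (a b c : n) :
    lowTensor C γ (c, b, a) = -lowTensor C γ (a, b, c) := by
  have := h.invariant a b c
  rw [Finset.sum_add_distrib] at this
  simp only [lowTensor]
  linarith

lemma lowTensor_swap_left (h : IsQuadraticLie C γ) (a b c : n) :
    lowTensor C γ (b, a, c) = -lowTensor C γ (a, b, c) := by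
  rw [h.lowTensor_swap_right, h.lowTensor_swap_outer, h.lowTensor_swap_right, neg_neg]

lemma eq_sum_inv_lowTensor (h : IsQuadraticLie C γ) (a b c : n) :
    C a b c = ∑ d, γ⁻¹ a d * lowTensor C γ (d, b, c) := by
  have h1 : (γ⁻¹ * γ) *ᵥ (fun d => C d b c) = fun d => C d b c := by
    rw [nonsing_inv_mul _ h.isUnit_det, one_mulVec]
  rw [← mulVec_mulVec] at h1
  exact (congrFun h1 a).symm

lemma upTensor_swap_right (h : IsQuadraticLie C γ) (a b c : n) :
    upTensor C γ (a, c, b) = -upTensor C γ (a, b, c) := by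
  simp only [upTensor, ← Finset.sum_neg_distrib]
  rw [Finset.sum_comm]
  refine Finset.sum_congr rfl fun d _ => Finset.sum_congr rfl fun e _ => ?_
  rw [h.antisymm a e d]
  ring

lemma upTensor_eq (h : IsQuadraticLie C γ) (a b c : n) :
    upTensor C γ (a, b, c) =
      ∑ a', ∑ b', ∑ c', γ⁻¹ a a' * γ⁻¹ b b' * γ⁻¹ c c' * lowTensor C γ (a', b', c') := by
  simp only [upTensor]
  rw [Finset.sum_comm]
  conv_rhs => rw [Finset.sum_comm]
  rw [Finset.sum_comm]
  refine Finset.sum_congr rfl fun b' _ => ?_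
  rw [Finset.sum_comm]
  refine Finset.sum_congr rfl fun c' _ => ?_
  rw [h.eq_sum_inv_lowTensor a b' c', Finset.mul_sum]
  exact Finset.sum_congr rfl fun d _ => by ring

lemma upTensor_swap_left (h : IsQuadraticLie C γ) (a b c : n) :
    upTensor C γ (b, a, c) = -upTensor C γ (a, b, c) := by
  rw [h.upTensor_eq, h.upTensor_eq, Finset.sum_comm]
  simp only [← Finset.sum_neg_distrib]
  refine Finset.sum_congr rfl fun d _ => Finset.sum_congr rfl fun e _ =>
    Finset.sum_congr rfl fun i _ => ?_
  rw [h.lowTensor_swap_left]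
  ring

lemma transpose_adMat_mul (h : IsQuadraticLie C γ) (a : n) :
    (adMat C a)ᵀ * γ = -(γ * adMat C a) := by
  ext b c
  have := h.lowTensor_swap_outer b a c
  simp only [lowTensor] at this
  simp only [Matrix.mul_apply, Matrix.neg_apply, transpose_apply, adMat, of_apply]
  rw [← this]
  refine Finset.sum_congr rfl fun d _ => ?_
  rw [mul_comm, ← congrFun (congrFun h.symm d) c, transpose_apply]

lemma transpose_adSum_mul (h : IsQuadraticLie C γ) (k : n → ℝ) :
    (adSum C k)ᵀ * γ = -(γ * adSum C k) := by
  simp only [adSum, transpose_sum, transpose_smul, Matrix.sum_mul, Matrix.mul_sum,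
    Matrix.smul_mul, Matrix.mul_smul, h.transpose_adMat_mul, smul_neg, Finset.sum_neg_distrib]

lemma adSum_commutator (h : IsQuadraticLie C γ) (k : n → ℝ) (b : n) :
    adSum C k * adMat C b - adMat C b * adSum C k = ∑ d, adSum C k d b • adMat C d := by
  have h1 : ∀ d, adSum C k d b = ∑ a, k a * C d a b := fun d => by
    simp [adSum, Matrix.sum_apply, adMat]
  simp only [h1, Finset.sum_smul]
  rw [Finset.sum_comm]
  simp only [mul_smul, ← Finset.smul_sum, ← h.jacobi]
  simp only [adSum, Matrix.sum_mul, Matrix.mul_sum, Matrix.smul_mul, Matrix.mul_smul,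
    ← Finset.sum_sub_distrib, smul_sub]

lemma adSum_commutator_adSum (h : IsQuadraticLie C γ) (k w : n → ℝ) :
    adSum C k * adSum C w - adSum C w * adSum C k = adSum C (adSum C k *ᵥ w) := by
  conv_lhs => rw [adSum.eq_1 C w]
  simp only [Matrix.sum_mul, Matrix.mul_sum, Matrix.smul_mul, Matrix.mul_smul,
    ← Finset.sum_sub_distrib, ← smul_sub, h.adSum_commutator, Finset.smul_sum]
  rw [Finset.sum_comm, adSum.eq_1 C (_ *ᵥ _)]
  simp only [mulVec, dotProduct, Finset.sum_smul, smul_smul]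
  exact Finset.sum_congr rfl fun d _ => Finset.sum_congr rfl fun b _ => by rw [mul_comm]

lemma lowTensor_invariant (h : IsQuadraticLie C γ) (k : n → ℝ) (a b c : n) :
    ∑ d, lowTensor C γ (d, b, c) * adSum C k d a + ∑ d, lowTensor C γ (a, d, c) * adSum C k d b +
      ∑ d, lowTensor C γ (a, b, d) * adSum C k d c = 0 := by
  have e0 : ∀ i j l, (γ * adMat C j) i l = lowTensor C γ (i, j, l) := fun _ _ _ => rfl
  have e1 := congrArg (γ * ·) (h.adSum_commutator k b)
  simp only [Matrix.mul_sub, ← Matrix.mul_assoc] at e1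
  rw [← neg_neg (γ * adSum C k), ← h.transpose_adSum_mul, Matrix.mul_sum] at e1
  have e2 := congrFun (congrFun e1 a) c
  simp only [Matrix.neg_mul, Matrix.mul_assoc, Matrix.sub_apply, Matrix.neg_apply,
    Matrix.sum_apply, Matrix.mul_smul, Matrix.smul_apply, e0, smul_eq_mul] at e2
  rw [← Matrix.mul_assoc γ, Matrix.mul_apply, Matrix.mul_apply] at e2
  simp only [e0, transpose_apply] at e2
  simp only [mul_comm (lowTensor C γ _)] at e2 ⊢
  linarith

lemma triForm_invariant (h : IsQuadraticLie C γ) (k : n → ℝ) {ε₁ ε₂ ε₃ : ℝ}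
    (hε : ε₁ + ε₂ + ε₃ = 0) (g : n × n × n → ℝ) (U V W : Matrix n n ℝ) :
    triForm (lowTensor C γ) g ((adSum C k + ε₁ • 1) * U) V W +
      triForm (lowTensor C γ) g U ((adSum C k + ε₂ • 1) * V) W +
      triForm (lowTensor C γ) g U V ((adSum C k + ε₃ • 1) * W) = 0 := by
  have e1 : triForm (lowTensor C γ) g (adSum C k * U) V W +
      triForm (lowTensor C γ) g U (adSum C k * V) W +
      triForm (lowTensor C γ) g U V (adSum C k * W) = 0 := by
    rw [triForm_mul_left, triForm_mul_middle, triForm_mul_right]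
    simp only [triForm]
    rw [← Finset.sum_add_distrib, ← Finset.sum_add_distrib]
    refine Finset.sum_eq_zero fun p _ => ?_
    rw [← Finset.sum_add_distrib, ← Finset.sum_add_distrib]
    refine Finset.sum_eq_zero fun q _ => ?_
    rw [← add_mul, ← add_mul, ← add_mul, ← add_mul, h.lowTensor_invariant, zero_mul, zero_mul]
  rw [← e1, ← sub_eq_zero]
  simp only [triForm, ← Finset.sum_add_distrib, ← Finset.sum_sub_distrib]
  refine Finset.sum_eq_zero fun p _ => Finset.sum_eq_zero fun q _ => ?_
  simp only [Matrix.add_mul, Matrix.smul_mul, Matrix.one_mul, Matrix.add_apply, Matrix.smul_apply,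
    smul_eq_mul]
  linear_combination (lowTensor C γ p * g q * (U p.1 q.1 * V p.2.1 q.2.1 * W p.2.2 q.2.2)) * hε

lemma sum_inv_mul_eq_upTensor (h : IsQuadraticLie C γ) (i j d e : n) :
    ∑ a, ∑ l, γ⁻¹ e a * C j a l * C l d i =
      -∑ l, lowTensor C γ (i, l, d) * upTensor C γ (j, l, e) := by
  have hs : ∀ a b, γ⁻¹ a b = γ⁻¹ b a := fun a b => congrFun (congrFun h.inv_transpose b) a
  have e1 : ∀ l, C l d i = ∑ m, γ⁻¹ m l * lowTensor C γ (i, m, d) := fun l => by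
    rw [h.eq_sum_inv_lowTensor l d i]
    refine Finset.sum_congr rfl fun m _ => ?_
    rw [hs l m, h.lowTensor_swap_right m i d, h.lowTensor_swap_left i m d, neg_neg]
  simp only [e1, h.upTensor_swap_right j e, mul_neg, Finset.sum_neg_distrib, neg_neg]
  simp only [upTensor, Finset.mul_sum]
  rw [Finset.sum_comm_cycle]
  refine Finset.sum_congr rfl fun m _ => ?_
  refine Finset.sum_congr rfl fun a _ => Finset.sum_congr rfl fun l _ => ?_
  ring

lemma sum_mul_trace_eq_triForm (h : IsQuadraticLie C γ) (U R : Matrix n n ℝ) :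
    ∑ a, ∑ d, (R * γ⁻¹) d a * (U * adMat C a * adMat C d).trace =
      -triForm (lowTensor C γ) (upTensor C γ) U 1 R := by
  have e1 : triForm (lowTensor C γ) (upTensor C γ) U 1 R =
      ∑ i, ∑ d, ∑ j, ∑ e, U i j * R d e *
        ∑ l, lowTensor C γ (i, l, d) * upTensor C γ (j, l, e) := by
    simp only [triForm, Fintype.sum_prod_type, Matrix.one_apply, mul_ite, ite_mul, mul_one,
      mul_zero, zero_mul, Finset.sum_ite_irrel, Finset.sum_const_zero, Finset.sum_ite_eq,
      Finset.mem_univ, if_true, Finset.mul_sum]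
    refine Finset.sum_congr rfl fun i _ => ?_
    rw [Finset.sum_comm]
    refine Finset.sum_congr rfl fun d _ => ?_
    rw [Finset.sum_comm]
    refine Finset.sum_congr rfl fun j _ => ?_
    rw [Finset.sum_comm]
    exact Finset.sum_congr rfl fun e _ => Finset.sum_congr rfl fun l _ => by ring
  have e2 : ∑ a, ∑ d, (R * γ⁻¹) d a * (U * adMat C a * adMat C d).trace =
      ∑ i, ∑ d, ∑ j, ∑ e, U i j * R d e * ∑ a, ∑ l, γ⁻¹ e a * C j a l * C l d i := by
    simp only [trace, diag, Matrix.mul_apply, Finset.mul_sum, Finset.sum_mul, adMat, of_apply]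
    rw [Finset.sum_comm_cycle]
    refine Finset.sum_congr rfl fun i _ => ?_
    rw [Finset.sum_comm]
    refine Finset.sum_congr rfl fun d _ => ?_
    rw [Finset.sum_comm_cycle]
    refine Finset.sum_congr rfl fun j _ => ?_
    rw [Finset.sum_comm_cycle]
    refine Finset.sum_congr rfl fun e _ => ?_
    exact Finset.sum_congr rfl fun a _ => Finset.sum_congr rfl fun l _ => by ring
  rw [e1, e2]
  simp only [h.sum_inv_mul_eq_upTensor, mul_neg, Finset.sum_neg_distrib]

end IsQuadraticLie

namespace IsQuadraticLie

variable {C : n → n → n → ℝ} {γ : Matrix n n ℝ}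

lemma inv_symm (h : IsQuadraticLie C γ) (a b : n) : γ⁻¹ a b = γ⁻¹ b a :=
  congrFun (congrFun h.inv_transpose b) a

lemma killing_eq_triForm (h : IsQuadraticLie C γ) :
    ∑ a, ∑ b, γ⁻¹ a b * (adMat C a * adMat C b).trace =
      -triForm (lowTensor C γ) (upTensor C γ) 1 1 1 := by
  rw [← h.sum_mul_trace_eq_triForm]
  refine Finset.sum_congr rfl fun a _ => Finset.sum_congr rfl fun b _ => ?_
  rw [Matrix.one_mul, Matrix.one_mul, h.inv_symm]

lemma trace_eq_of_transpose_mul (h : IsQuadraticLie C γ) {M K : Matrix n n ℝ}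
    (hM : Mᵀ * γ = γ * K) : M.trace = K.trace := by
  rw [← trace_transpose M, ← Matrix.mul_one Mᵀ, ← mul_nonsing_inv _ h.isUnit_det,
    ← Matrix.mul_assoc, hM, trace_mul_comm, ← Matrix.mul_assoc, nonsing_inv_mul _ h.isUnit_det,
    Matrix.one_mul]

lemma trace_mul_adMat (h : IsQuadraticLie C γ) (K : Matrix n n ℝ) (b : n) :
    (K * adMat C b).trace = ∑ e, ∑ a, (K * γ⁻¹) e a * lowTensor C γ (b, e, a) := by
  have e1 : ∀ l e, C l b e = ∑ a, γ⁻¹ l a * lowTensor C γ (b, e, a) := fun l e => by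
    rw [h.eq_sum_inv_lowTensor l b e]
    refine Finset.sum_congr rfl fun a _ => ?_
    rw [h.lowTensor_swap_left b a e, h.lowTensor_swap_right b e a, neg_neg]
  simp only [trace, diag, Matrix.mul_apply, adMat, of_apply, e1, Finset.mul_sum, Finset.sum_mul]
  refine Finset.sum_congr rfl fun e _ => ?_
  rw [Finset.sum_comm]
  exact Finset.sum_congr rfl fun a _ => Finset.sum_congr rfl fun l _ => by ring

lemma sum_mul_structure (h : IsQuadraticLie C γ) (K : Matrix n n ℝ) (d : n) :
    ∑ a, ∑ b, (K * γ⁻¹) a b * C d a b = ∑ b, γ⁻¹ d b * (K * adMat C b).trace := by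
  simp only [h.trace_mul_adMat, h.eq_sum_inv_lowTensor d, Finset.mul_sum]
  rw [Finset.sum_comm_cycle]
  exact Finset.sum_congr rfl fun i _ => Finset.sum_congr rfl fun a _ =>
    Finset.sum_congr rfl fun b _ => by ring

lemma sum_mul_structure_mul_trace (h : IsQuadraticLie C γ) (K : Matrix n n ℝ) :
    ∑ a, ∑ b, (K * γ⁻¹) a b * ∑ d, C d a b * (K * adMat C d).trace =
      ∑ a, ∑ b, γ⁻¹ a b * ((K * adMat C a).trace * (K * adMat C b).trace) := by
  calc _ = ∑ d, (∑ a, ∑ b, (K * γ⁻¹) a b * C d a b) * (K * adMat C d).trace := by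
        simp only [Finset.mul_sum, Finset.sum_mul]
        rw [Finset.sum_comm_cycle]
        exact Finset.sum_congr rfl fun i _ => Finset.sum_congr rfl fun a _ =>
          Finset.sum_congr rfl fun b _ => by ring
    _ = _ := by
        simp only [h.sum_mul_structure, Finset.sum_mul]
        exact Finset.sum_congr rfl fun a _ => Finset.sum_congr rfl fun b _ => by ring

lemma sum_trace_mul_trace (h : IsQuadraticLie C γ) {K : Matrix n n ℝ}
    (hK : Kᵀ * γ = -(γ * K)) :
    ∑ a, ∑ b, γ⁻¹ a b * ((K * adMat C a).trace * (K * adMat C b).trace) =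
      2 * triForm (lowTensor C γ) (upTensor C γ) K 1 K := by
  have e1 : (K * γ⁻¹)ᵀ = -(K * γ⁻¹) := by
    have e2 : γ⁻¹ * (Kᵀ * γ) * γ⁻¹ = γ⁻¹ * Kᵀ := by
      rw [Matrix.mul_assoc, Matrix.mul_assoc, mul_nonsing_inv _ h.isUnit_det, Matrix.mul_one]
    rw [transpose_mul, h.inv_transpose, ← e2, hK, Matrix.mul_neg, ← Matrix.mul_assoc,
      nonsing_inv_mul _ h.isUnit_det, Matrix.one_mul, Matrix.neg_mul]
  have e3 : ∀ a d, (K * γ⁻¹) d a = -(K * γ⁻¹) a d := fun a d => congrFun (congrFun e1 a) d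
  have e4 : ∀ a d, ∑ e, C e a d * (K * adMat C e).trace =
      (K * adMat C a * adMat C d).trace - (K * adMat C d * adMat C a).trace := fun a d => by
    rw [← trace_sub, Matrix.mul_assoc, Matrix.mul_assoc, ← Matrix.mul_sub, h.jacobi,
      Matrix.mul_sum, trace_sum]
    simp only [Matrix.mul_smul, trace_smul, smul_eq_mul]
  have e5 := h.sum_mul_trace_eq_triForm K K
  have e6 : ∑ a, ∑ d, (K * γ⁻¹) a d * (K * adMat C a * adMat C d).trace =
      triForm (lowTensor C γ) (upTensor C γ) K 1 K := by
    rw [← neg_neg (triForm _ _ _ _ _), ← e5]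
    simp only [← Finset.sum_neg_distrib]
    exact Finset.sum_congr rfl fun a _ => Finset.sum_congr rfl fun d _ => by rw [e3 a d]; ring
  rw [Finset.sum_comm] at e5
  rw [← h.sum_mul_structure_mul_trace]
  simp only [e4, mul_sub, Finset.sum_sub_distrib]
  linarith

lemma sum_matHDiff (h : IsQuadraticLie C γ) (k : n → ℝ) {ε₁ ε₂ ε₃ : ℝ} (hε : ε₁ + ε₂ + ε₃ = 0)
    (h₃ : IsUnit (adSum C k + ε₃ • 1)) (h₁ : IsUnit (matY (adSum C k + ε₁ • 1)))
    (h₂ : IsUnit (matY (adSum C k - ε₂ • 1)))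
    (hT : (matH (adSum C k - ε₂ • 1))ᵀ * γ = -(γ * matH (adSum C k + ε₂ • 1))) :
    ∑ a, ∑ b, γ⁻¹ a b * (matHDiff (adSum C k + ε₁ • 1) (adMat C a) (adSum C k - ε₂ • 1) *
        adMat C b).trace =
      triForm (lowTensor C γ) (upTensor C γ) (matH (adSum C k + ε₁ • 1)) 1
          (adSum C k + ε₃ • 1)⁻¹ +
        triForm (lowTensor C γ) (upTensor C γ) (matH (adSum C k + ε₂ • 1)) 1
          (adSum C k + ε₃ • 1)⁻¹ := by
  set X := adSum C k + ε₁ • 1 with hX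
  set W := adSum C k - ε₂ • 1 with hW
  set H := matH X + matH (adSum C k + ε₂ • 1) with hH
  set R := (adSum C k + ε₃ • 1)⁻¹ with hR
  let m : Matrix n n ℝ := of fun a b => (matHDiff X (adMat C a) W * adMat C b).trace
  let m' : Matrix n n ℝ := of fun a b => (H * adMat C a * adMat C b).trace
  have e1 : m * (adSum C k + ε₃ • 1) = -m' := by
    ext a b
    have e2 := congrArg (fun M => (M * adMat C b).trace)
      (matHDiff_commutator (D := adMat C a) h₁ h₂)
    simp only [Matrix.sub_mul, trace_sub] at e2
    have e3 : (adMat C a * matH W * adMat C b).trace =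
        -(matH (adSum C k + ε₂ • 1) * adMat C a * adMat C b).trace := by
      have e8 : (adMat C a * matH W * adMat C b)ᵀ * γ =
          γ * -(adMat C b * matH (adSum C k + ε₂ • 1) * adMat C a) := by
        rw [transpose_mul, transpose_mul, Matrix.mul_assoc, Matrix.mul_assoc,
          h.transpose_adMat_mul, Matrix.mul_neg, ← Matrix.mul_assoc, hT, Matrix.neg_mul, neg_neg,
          ← Matrix.mul_assoc, ← Matrix.mul_assoc, h.transpose_adMat_mul]
        simp only [Matrix.neg_mul, Matrix.mul_neg, Matrix.mul_assoc]
      rw [h.trace_eq_of_transpose_mul e8, trace_neg, ← trace_mul_cycle]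
    have e4 : adMat C b * X - W * adMat C b = -∑ d, adSum C k d b • adMat C d - ε₃ • adMat C b := by
      rw [← h.adSum_commutator, hX, hW, ← neg_eq_of_add_eq_zero_right hε]
      simp only [Matrix.mul_add, Matrix.sub_mul, Matrix.mul_smul, Matrix.smul_mul, Matrix.mul_one,
        Matrix.one_mul]
      module
    have e5 : (matHDiff X (adMat C a) W * (adMat C b * X - W * adMat C b)).trace =
        -(m * (adSum C k + ε₃ • 1)) a b := by
      rw [e4, Matrix.mul_add, Matrix.mul_smul, Matrix.mul_one, Matrix.add_apply,
        Matrix.smul_apply, Matrix.mul_apply, Matrix.mul_sub, Matrix.mul_neg, Matrix.mul_sum,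
        trace_sub, trace_neg, trace_sum]
      simp only [Matrix.mul_smul, trace_smul, smul_eq_mul, m, of_apply, mul_comm (adSum C k _ _)]
      ring
    rw [Matrix.mul_sub, trace_sub, ← Matrix.mul_assoc, ← Matrix.mul_assoc] at e5
    rw [Matrix.mul_assoc X, trace_mul_comm X, e3] at e2
    simp only [Matrix.neg_apply, m', of_apply, hH, Matrix.add_mul, trace_add]
    linarith
  have e6 : m = -m' * R := by
    rw [← e1, Matrix.mul_assoc, hR, mul_nonsing_inv _ ((isUnit_iff_isUnit_det _).1 h₃),
      Matrix.mul_one]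
  have e7 : ∑ a, ∑ b, γ⁻¹ a b * m a b = -∑ a, ∑ d, (R * γ⁻¹) d a * m' a d := by
    rw [e6]
    simp only [Matrix.mul_apply, Finset.mul_sum, Finset.sum_mul, ← Finset.sum_neg_distrib]
    refine Finset.sum_congr rfl fun a _ => ?_
    rw [Finset.sum_comm]
    refine Finset.sum_congr rfl fun d _ => Finset.sum_congr rfl fun b _ => ?_
    rw [h.inv_symm a b, Matrix.neg_apply]
    ring
  refine e7.trans ?_
  refine (congrArg Neg.neg (h.sum_mul_trace_eq_triForm H R)).trans ?_
  rw [neg_neg, hH]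
  simp only [triForm, ← Finset.sum_add_distrib]
  refine Finset.sum_congr rfl fun p _ => Finset.sum_congr rfl fun q _ => ?_
  rw [Matrix.add_apply]
  ring

end IsQuadraticLie

lemma matPowSum_transpose (c : ℕ → ℝ) (X : Matrix n n ℝ) : matPowSum c Xᵀ = (matPowSum c X)ᵀ := by
  simp only [matPowSum, transpose_tsum, transpose_smul, transpose_pow]

lemma inv_mul_eq_mul_inv_of_mul_comm {A B : Matrix n n ℝ} (hA : IsUnit A) (h : A * B = B * A) :
    A⁻¹ * B = B * A⁻¹ := by
  have hA' := (isUnit_iff_isUnit_det _).1 hA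
  calc A⁻¹ * B = A⁻¹ * (B * A) * A⁻¹ := by
        rw [Matrix.mul_assoc, Matrix.mul_assoc, mul_nonsing_inv _ hA', Matrix.mul_one]
    _ = B * A⁻¹ := by
        rw [← h, ← Matrix.mul_assoc, nonsing_inv_mul _ hA', Matrix.one_mul]

lemma matDY_mul_inv_matY {X : Matrix n n ℝ} (hX : IsUnit (matY X)) :
    matDY X * (matY X)⁻¹ = (matY X)⁻¹ * matDY X :=
  (inv_mul_eq_mul_inv_of_mul_comm hX (matPowSum_intertwine expBounded_matDY
    (matPowSum_intertwine expBounded_matY rfl).symm).symm).symm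

lemma matH_transpose (X : Matrix n n ℝ) (hX : IsUnit (matY X)) : matH Xᵀ = (matH X)ᵀ := by
  have h1 : matY Xᵀ = (matY X)ᵀ := matPowSum_transpose _ X
  have h2 : matDY Xᵀ = (matDY X)ᵀ := matPowSum_transpose _ X
  rw [matH, matH, matDY_mul_inv_matY hX, h1, h2, transpose_add, transpose_mul,
    transpose_nonsing_inv]
  simp

lemma eventually_isUnit_add_smul (Z : Matrix n n ℝ) {r : ℝ} (hr : r ≠ 0) :
    ∀ᶠ t : ℝ in 𝓝[≠] 0, IsUnit (Z + (r * t) • (1 : Matrix n n ℝ)) := by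
  have h1 : ((-Z).charpoly.roots.toFinset : Set ℝ).Finite := Finset.finite_toSet _
  have h2 : ∀ᶠ s : ℝ in 𝓝[≠] 0, s ∉ ((-Z).charpoly.roots.toFinset : Set ℝ) := by
    have h3 : ((-Z).charpoly.roots.toFinset \ {0} : Set ℝ)ᶜ ∈ 𝓝 (0 : ℝ) :=
      (h1.subset Set.sdiff_subset).isClosed.isOpen_compl.mem_nhds (by simp)
    filter_upwards [nhdsWithin_le_nhds h3, self_mem_nhdsWithin] with s hs hs0 hs1
    exact hs ⟨hs1, hs0⟩
  have h4 : Tendsto (fun t : ℝ => r * t) (𝓝[≠] 0) (𝓝[≠] 0) := by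
    refine tendsto_nhdsWithin_iff.2 ⟨?_, ?_⟩
    · have : Tendsto (fun t : ℝ => r * t) (𝓝 0) (𝓝 (r * 0)) := tendsto_id.const_mul r
      rw [mul_zero] at this
      exact this.mono_left nhdsWithin_le_nhds
    · filter_upwards [self_mem_nhdsWithin] with t ht
      exact mul_ne_zero hr ht
  filter_upwards [h4.eventually h2] with t ht
  rw [isUnit_iff_isUnit_det, isUnit_iff_ne_zero]
  intro h0
  apply ht
  simp only [Finset.mem_coe, Multiset.mem_toFinset]
  rw [Polynomial.mem_roots (charpoly_monic _).ne_zero, Polynomial.IsRoot, eval_charpoly]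
  rw [← h0]
  congr 1
  rw [sub_neg_eq_add, add_comm, smul_one_eq_diagonal]
  rfl

lemma continuous_matY : Continuous (matY : Matrix n n ℝ → Matrix n n ℝ) :=
  continuous_matPowSum expBounded_matY

lemma eventually_isUnit_matY {Z : Matrix n n ℝ} (hZ : IsUnit (matY Z)) :
    ∀ᶠ W in 𝓝 Z, IsUnit (matY W) := by
  have h1 : ContinuousAt (fun W : Matrix n n ℝ => (matY W).det) Z :=
    (continuous_matY.matrix_det).continuousAt
  have h2 := (isUnit_iff_isUnit_det _).1 hZ
  filter_upwards [h1.eventually_ne h2.ne_zero] with W hW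
  exact (isUnit_iff_isUnit_det _).2 (isUnit_iff_ne_zero.2 hW)

lemma tendsto_triForm {α : Type*} {l : Filter α} {U V W : α → Matrix n n ℝ}
    {U₀ V₀ W₀ : Matrix n n ℝ} (f g : n × n × n → ℝ) (hU : Tendsto U l (𝓝 U₀))
    (hV : Tendsto V l (𝓝 V₀)) (hW : Tendsto W l (𝓝 W₀)) :
    Tendsto (fun t => triForm f g (U t) (V t) (W t)) l (𝓝 (triForm f g U₀ V₀ W₀)) := by
  have he : ∀ {F : α → Matrix n n ℝ} {F₀ : Matrix n n ℝ}, Tendsto F l (𝓝 F₀) → ∀ i j,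
      Tendsto (fun t => F t i j) l (𝓝 (F₀ i j)) := fun hF i j =>
    tendsto_pi_nhds.1 (tendsto_pi_nhds.1 hF i) j
  refine tendsto_finsetSum _ fun p _ => tendsto_finsetSum _ fun q _ => ?_
  exact (((he hU _ _).mul (he hV _ _)).mul (he hW _ _)).const_mul _

lemma continuousAt_matHDiff {X D W : Matrix n n ℝ} (hX : IsUnit (matY X)) (hW : IsUnit (matY W)) :
    ContinuousAt (fun P : Matrix n n ℝ × Matrix n n ℝ => matHDiff P.1 D P.2) (X, W) := by
  have h1 : ContinuousAt (fun P : Matrix n n ℝ × Matrix n n ℝ => matH (fromBlocks P.1 D 0 P.2))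
      (X, W) := by
    refine ContinuousAt.comp (f := fun P : Matrix n n ℝ × Matrix n n ℝ => fromBlocks P.1 D 0 P.2)
      (continuousAt_matH (isUnit_matY_block hX hW)) ?_
    exact Continuous.continuousAt (by fun_prop)
  refine ContinuousAt.comp (g := toBlocks₁₂) ?_ h1
  exact (continuous_matrix fun i j => continuous_id.matrix_elem _ _).continuousAt

lemma tendsto_sum_matHDiff {α : Type*} {l : Filter α} {γ' Z : Matrix n n ℝ} (D : n → Matrix n n ℝ)
    (hZ : IsUnit (matY Z)) {X W : α → Matrix n n ℝ} (hX : Tendsto X l (𝓝 Z))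
    (hW : Tendsto W l (𝓝 Z)) :
    Tendsto (fun t => ∑ a, ∑ b, γ' a b * (matHDiff (X t) (D a) (W t) * D b).trace) l
      (𝓝 (∑ a, ∑ b, γ' a b * (matHDiff Z (D a) Z * D b).trace)) := by
  have h2 : ∀ a, Tendsto (fun t => matHDiff (X t) (D a) (W t)) l (𝓝 (matHDiff Z (D a) Z)) :=
    fun a => by
      have h0 : Tendsto (fun P : Matrix n n ℝ × Matrix n n ℝ => matHDiff P.1 (D a) P.2)
        (𝓝 (Z, Z)) (𝓝 (matHDiff Z (D a) Z)) := continuousAt_matHDiff hZ hZ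
      generalize (matHDiff : Matrix n n ℝ → Matrix n n ℝ → Matrix n n ℝ → Matrix n n ℝ) = F at *
      exact h0.comp (hX.prodMk_nhds hW)
  generalize (matHDiff : Matrix n n ℝ → Matrix n n ℝ → Matrix n n ℝ → Matrix n n ℝ) = F at *
  have h1 : ∀ a b, Continuous fun M : Matrix n n ℝ => γ' a b * (M * D b).trace :=
    fun a b => (Continuous.matrix_trace (continuous_id.matrix_mul continuous_const)).const_mul _
  exact tendsto_finsetSum _ fun a _ => tendsto_finsetSum _ fun b _ =>
    ((h1 a b).tendsto (F Z (D a) Z)).comp (h2 a)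

namespace IsQuadraticLie

variable {C : n → n → n → ℝ} {γ : Matrix n n ℝ}

lemma transpose_matH_mul (h : IsQuadraticLie C γ) {X W : Matrix n n ℝ} (hXW : Xᵀ * γ = γ * W)
    (hX : IsUnit (matY X)) : IsUnit (matY W) ∧ (matH X)ᵀ * γ = γ * matH W := by
  have h1 : IsUnit (matY Xᵀ) := by
    rw [isUnit_iff_isUnit_det, matY, matPowSum_transpose, det_transpose]
    exact (isUnit_iff_isUnit_det _).1 hX
  have h2 : IsUnit (matY W) := by
    have h3 : matY Xᵀ * γ = γ * matY W := matPowSum_intertwine expBounded_matY hXW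
    have h4 : IsUnit (γ * matY W) := h3 ▸ h1.mul h.isUnit
    rw [isUnit_iff_isUnit_det, det_mul] at *
    exact isUnit_of_mul_isUnit_right h4
  exact ⟨h2, by rw [← matH_transpose X hX, matH_intertwine h1 h2 hXW]⟩

lemma transpose_matH_add_smul (h : IsQuadraticLie C γ) (k : n → ℝ) {ε : ℝ}
    (hu : IsUnit (adSum C k + ε • 1)) (h₁ : IsUnit (matY (adSum C k + ε • 1)))
    (h₂ : IsUnit (matY (adSum C k - ε • 1))) :
    (matH (adSum C k - ε • 1))ᵀ * γ = -(γ * matH (adSum C k + ε • 1)) := by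
  have h3 := h.transpose_matH_mul (W := -(adSum C k + ε • 1)) (by
    rw [transpose_sub, Matrix.sub_mul, h.transpose_adSum_mul, Matrix.mul_neg, Matrix.mul_add,
      transpose_smul, transpose_one, Matrix.smul_mul, Matrix.mul_smul, Matrix.one_mul,
      Matrix.mul_one]
    abel) h₂
  rw [h3.2, matH_neg hu h₁ h3.1, Matrix.mul_neg]

lemma sum_matHDiff_cycle (h : IsQuadraticLie C γ) (k : n → ℝ) {ε₁ ε₂ ε₃ : ℝ}
    (hε : ε₁ + ε₂ + ε₃ = 0)
    (h₁ : IsUnit (adSum C k + ε₁ • 1)) (h₂ : IsUnit (adSum C k + ε₂ • 1))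
    (h₃ : IsUnit (adSum C k + ε₃ • 1))
    (hY₁ : IsUnit (matY (adSum C k + ε₁ • 1))) (hY₂ : IsUnit (matY (adSum C k + ε₂ • 1)))
    (hY₃ : IsUnit (matY (adSum C k + ε₃ • 1)))
    (hY₂' : IsUnit (matY (adSum C k - ε₂ • 1))) (hY₃' : IsUnit (matY (adSum C k - ε₃ • 1))) :
    (∑ a, ∑ b, γ⁻¹ a b * (matHDiff (adSum C k + ε₁ • 1) (adMat C a) (adSum C k - ε₂ • 1) *
        adMat C b).trace) +
      (∑ a, ∑ b, γ⁻¹ a b * (matHDiff (adSum C k + ε₁ • 1) (adMat C a) (adSum C k - ε₃ • 1) *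
        adMat C b).trace) +
      (∑ a, ∑ b, γ⁻¹ a b * (matHDiff (adSum C k + ε₂ • 1) (adMat C a) (adSum C k - ε₃ • 1) *
        adMat C b).trace) =
      (1 / 4) * ∑ a, ∑ b, γ⁻¹ a b * (adMat C a * adMat C b).trace -
        (triForm (lowTensor C γ) (upTensor C γ) (matH (adSum C k + ε₁ • 1)) 1
          (matH (adSum C k + ε₂ • 1)) +
        triForm (lowTensor C γ) (upTensor C γ) (matH (adSum C k + ε₁ • 1)) 1
          (matH (adSum C k + ε₃ • 1)) +
        triForm (lowTensor C γ) (upTensor C γ) (matH (adSum C k + ε₂ • 1)) 1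
          (matH (adSum C k + ε₃ • 1))) := by
  rw [h.sum_matHDiff k hε h₃ hY₁ hY₂' (h.transpose_matH_add_smul k h₂ hY₂ hY₂'),
    h.sum_matHDiff k (ε₁ := ε₁) (ε₂ := ε₃) (ε₃ := ε₂) (by linarith) h₂ hY₁ hY₃'
      (h.transpose_matH_add_smul k h₃ hY₃ hY₃'),
    h.sum_matHDiff k (ε₁ := ε₂) (ε₂ := ε₃) (ε₃ := ε₁) (by linarith) h₁ hY₂ hY₃'
      (h.transpose_matH_add_smul k h₃ hY₃ hY₃'), h.killing_eq_triForm]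
  have e1 := triForm_matH (h.triForm_invariant k hε (upTensor C γ)) h₁ h₂ h₃ hY₁ hY₂ hY₃
  have e2 : ∀ U V W, triForm (lowTensor C γ) (upTensor C γ) U W V =
      triForm (lowTensor C γ) (upTensor C γ) U V W :=
    triForm_swap_right h.lowTensor_swap_right h.upTensor_swap_right
  have e3 : ∀ U V W, triForm (lowTensor C γ) (upTensor C γ) V U W =
      triForm (lowTensor C γ) (upTensor C γ) U V W :=
    triForm_swap_left h.lowTensor_swap_left h.upTensor_swap_left
  generalize matH (adSum C k + ε₁ • 1) = H₁ at *
  generalize matH (adSum C k + ε₂ • 1) = H₂ at *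
  generalize matH (adSum C k + ε₃ • 1) = H₃ at *
  generalize (adSum C k + ε₁ • 1)⁻¹ = R₁ at *
  generalize (adSum C k + ε₂ • 1)⁻¹ = R₂ at *
  generalize (adSum C k + ε₃ • 1)⁻¹ = R₃ at *
  generalize triForm (lowTensor C γ) (upTensor C γ) = T at *
  have e4 : ∀ U V, T V 1 U = T U 1 V := fun U V => by rw [e2 V U 1, e3 U V 1, e2 U 1 V]
  have e5 : ∀ U V, T U V 1 = T U 1 V := fun U V => e2 U 1 V
  have e6 : ∀ U V, T 1 U V = T U 1 V := fun U V => e3 U 1 V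
  simp only [e5, e6] at e1 ⊢
  linarith [e4 H₂ R₁, e4 H₃ R₁, e4 H₃ R₂]

/-- The skewness of `matH` at an adjoint matrix. -/
lemma transpose_matH_adSum_mul (h : IsQuadraticLie C γ) (k : n → ℝ)
    (hY : IsUnit (matY (adSum C k))) :
    (matH (adSum C k))ᵀ * γ = -(γ * matH (adSum C k)) := by
  have hc : ∀ r : ℝ, Tendsto (fun t : ℝ => adSum C k + (r * t) • (1 : Matrix n n ℝ)) (𝓝[≠] 0)
      (𝓝 (adSum C k)) := fun r => by
    have : Continuous fun t : ℝ => adSum C k + (r * t) • (1 : Matrix n n ℝ) := by fun_prop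
    simpa using (this.tendsto 0).mono_left nhdsWithin_le_nhds
  have h1 : Tendsto (fun t : ℝ => (matH (adSum C k + (-1 * t) • (1 : Matrix n n ℝ)))ᵀ * γ) (𝓝[≠] 0)
      (𝓝 ((matH (adSum C k))ᵀ * γ)) := by
    have h2 : Continuous fun M : Matrix n n ℝ => Mᵀ * γ := by fun_prop
    exact (h2.tendsto _).comp ((continuousAt_matH hY).tendsto.comp (hc (-1)))
  have h3 : Tendsto (fun t : ℝ => -(γ * matH (adSum C k + (1 * t) • (1 : Matrix n n ℝ)))) (𝓝[≠] 0)
      (𝓝 (-(γ * matH (adSum C k)))) := by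
    have h2 : Continuous fun M : Matrix n n ℝ => -(γ * M) := by fun_prop
    exact (h2.tendsto _).comp ((continuousAt_matH hY).tendsto.comp (hc 1))
  refine tendsto_nhds_unique h1 (h3.congr' ?_)
  filter_upwards [eventually_isUnit_add_smul (adSum C k) one_ne_zero,
    (hc 1).eventually (eventually_isUnit_matY hY),
    (hc (-1)).eventually (eventually_isUnit_matY hY)] with t hu h4 h5
  have e1 : adSum C k + (-1 * t) • (1 : Matrix n n ℝ) = adSum C k - (1 * t) • 1 := by module
  rw [e1] at h5 ⊢
  exact (h.transpose_matH_add_smul k hu h4 h5).symm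

lemma sum_matHDiff_self (h : IsQuadraticLie C γ) (k : n → ℝ) (hY : IsUnit (matY (adSum C k))) :
    ∑ a, ∑ b, γ⁻¹ a b * (matHDiff (adSum C k) (adMat C a) (adSum C k) * adMat C b).trace =
      (1 / 12) * ∑ a, ∑ b, γ⁻¹ a b * (adMat C a * adMat C b).trace -
      (1 / 2) * ∑ a, ∑ b, γ⁻¹ a b * ((matH (adSum C k) * adMat C a).trace *
        (matH (adSum C k) * adMat C b).trace) := by
  have hc : ∀ r : ℝ, Tendsto (fun t : ℝ => adSum C k + (r * t) • (1 : Matrix n n ℝ)) (𝓝[≠] 0)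
      (𝓝 (adSum C k)) := fun r => by
    have : Continuous fun t : ℝ => adSum C k + (r * t) • (1 : Matrix n n ℝ) := by fun_prop
    simpa using (this.tendsto 0).mono_left nhdsWithin_le_nhds
  have hc' : ∀ r : ℝ, Tendsto (fun t : ℝ => adSum C k - (r * t) • (1 : Matrix n n ℝ)) (𝓝[≠] 0)
      (𝓝 (adSum C k)) := fun r => by
    have : Continuous fun t : ℝ => adSum C k - (r * t) • (1 : Matrix n n ℝ) := by fun_prop
    simpa using (this.tendsto 0).mono_left nhdsWithin_le_nhds
  have hB := fun r s => tendsto_sum_matHDiff (γ' := γ⁻¹) (adMat C) hY (hc r) (hc' s)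
  have hH : ∀ r : ℝ, Tendsto (fun t : ℝ => matH (adSum C k + (r * t) • (1 : Matrix n n ℝ)))
      (𝓝[≠] 0) (𝓝 (matH (adSum C k))) := fun r =>
    (continuousAt_matH hY).tendsto.comp (hc r)
  have hT := fun r s => tendsto_triForm (lowTensor C γ) (upTensor C γ) (hH r)
    (tendsto_const_nhds (x := (1 : Matrix n n ℝ))) (hH s)
  have h1 := ((hB 1 1).add (hB 1 (-2))).add (hB 1 (-2))
  have h2 := (((hT 1 1).add (hT 1 (-2))).add (hT 1 (-2))).const_sub
    ((1 / 4) * ∑ a, ∑ b, γ⁻¹ a b * (adMat C a * adMat C b).trace)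
  have h3 := tendsto_nhds_unique_of_eventuallyEq h1 h2 (by
    filter_upwards [eventually_isUnit_add_smul (adSum C k) one_ne_zero,
      eventually_isUnit_add_smul (adSum C k) (r := -2) (by norm_num),
      (hc 1).eventually (eventually_isUnit_matY hY),
      (hc (-2)).eventually (eventually_isUnit_matY hY),
      (hc' 1).eventually (eventually_isUnit_matY hY),
      (hc' (-2)).eventually (eventually_isUnit_matY hY)] with t hu hu' h4 h5 h6 h7
    exact h.sum_matHDiff_cycle k (by ring) hu hu hu' h4 h4 h5 h6 h7)
  rw [h.sum_trace_mul_trace (h.transpose_matH_adSum_mul k hY)]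
  linarith

end IsQuadraticLie

lemma hasDerivAt_det_of_eq_one {A : ℝ → Matrix n n ℝ} {A' : Matrix n n ℝ} {t₀ : ℝ}
    (hA : ∀ i j, HasDerivAt (fun t => A t i j) (A' i j) t₀) (h1 : A t₀ = 1) :
    HasDerivAt (fun t => (A t).det) A'.trace t₀ := by
  have h2 : HasDerivAt (fun t => ∑ σ : Equiv.Perm n, ((Equiv.Perm.sign σ : ℤ) : ℝ) *
      ∏ i, A t (σ i) i) (∑ σ : Equiv.Perm n, ((Equiv.Perm.sign σ : ℤ) : ℝ) *
      ∑ i, (∏ j ∈ Finset.univ.erase i, A t₀ (σ j) j) • A' (σ i) i) t₀ :=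
    HasDerivAt.fun_sum fun σ _ => (HasDerivAt.fun_finsetProd fun i _ => hA (σ i) i).const_mul _
  convert h2 using 1
  · ext t
    rw [det_apply']
  · rw [Finset.sum_eq_single 1]
    · rw [Equiv.Perm.sign_one, Units.val_one, Int.cast_one, one_mul]
      refine Finset.sum_congr rfl fun i _ => ?_
      have h3 : ∏ j ∈ Finset.univ.erase i, A t₀ ((1 : Equiv.Perm n) j) j = 1 := by
        refine Finset.prod_eq_one fun j _ => ?_
        rw [h1, Equiv.Perm.one_apply, one_apply_eq]
      rw [h3, one_smul]
      rfl
    · intro σ _ hσ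
      rw [Finset.sum_eq_zero, mul_zero]
      intro i _
      obtain ⟨j, hj, hji⟩ : ∃ j, σ j ≠ j ∧ j ≠ i := by
        obtain ⟨j, hj⟩ : ∃ j, σ j ≠ j := by
          by_contra! h
          exact hσ (Equiv.ext h)
        by_cases hji : j = i
        · exact ⟨σ j, fun h => hj (σ.injective h), fun h => hj (h.trans hji.symm)⟩
        · exact ⟨j, hj, hji⟩
      rw [Finset.prod_eq_zero (i := j) (by simp [hji]) (by rw [h1, one_apply_ne hj]), zero_smul]
    · simp

lemma hasDerivAt_det {M : ℝ → Matrix n n ℝ} {M' : Matrix n n ℝ} {t₀ : ℝ}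
    (hM : ∀ i j, HasDerivAt (fun t => M t i j) (M' i j) t₀) (hu : IsUnit (M t₀)) :
    HasDerivAt (fun t => (M t).det) ((M t₀).det * ((M t₀)⁻¹ * M').trace) t₀ := by
  have hu' := (isUnit_iff_isUnit_det _).1 hu
  have h1 : HasDerivAt (fun t => ((M t₀)⁻¹ * M t).det) ((M t₀)⁻¹ * M').trace t₀ :=
    hasDerivAt_det_of_eq_one (fun i j => by
      simp only [Matrix.mul_apply]
      exact HasDerivAt.fun_sum fun l _ => (hM l j).const_mul _) (nonsing_inv_mul _ hu')
  refine (h1.const_mul (M t₀).det).congr_of_eventuallyEq (Eventually.of_forall fun t => ?_)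
  show (M t).det = (M t₀).det * ((M t₀)⁻¹ * M t).det
  rw [← det_mul, ← Matrix.mul_assoc, mul_nonsing_inv _ hu', Matrix.one_mul]

lemma hasDerivAt_det_matY {Z D : Matrix n n ℝ} (hZ : IsUnit (matY Z)) (hD : D.trace = 0) :
    HasDerivAt (fun t : ℝ => (matY (Z + t • D)).det) ((matY Z).det * (matH Z * D).trace) 0 := by
  have h1 := hasDerivAt_det (fun i j => hasDerivAt_of_block (g := matY) (G := matY) (Z := Z)
    (D := D) continuous_matY.continuousAt
    (Eventually.of_forall fun t J X _ h => matPowSum_intertwine expBounded_matY h) i j)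
    (by simpa using hZ)
  rw [zero_smul, add_zero] at h1
  have hG : Commute (matY Z)⁻¹ Z :=
    inv_mul_eq_mul_inv_of_mul_comm hZ (matPowSum_intertwine expBounded_matY rfl)
  have h2 := trace_mul_matPowSum_block expBounded_matY expBounded_matDY (D := D) hG
  convert h1 using 2
  refine Eq.trans ?_ h2.symm
  rw [matH, Matrix.add_mul, trace_add, matDY_mul_inv_matY hZ, Matrix.smul_mul, Matrix.one_mul,
    trace_smul, hD, smul_zero, add_zero]
  rfl

lemma hasDerivAt_sqrt_det_matY {Z D : Matrix n n ℝ} (hZ : 0 < (matY Z).det) (hD : D.trace = 0) :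
    HasDerivAt (fun t : ℝ => √((matY (Z + t • D))⁻¹.det))
      (-(1 / 2) * √((matY Z)⁻¹.det) * (matH Z * D).trace) 0 := by
  have hu : IsUnit (matY Z) := (isUnit_iff_isUnit_det _).2 hZ.ne'.isUnit
  have h1 := hasDerivAt_det_matY hu hD
  have h0 : (matY (Z + (0 : ℝ) • D)).det = (matY Z).det := by rw [zero_smul, add_zero]
  have h2 := (h1.fun_inv (by rw [h0]; exact hZ.ne')).sqrt (by
    rw [h0]
    exact inv_ne_zero hZ.ne')
  rw [h0] at h2
  simp only [det_nonsing_inv, Ring.inverse_eq_inv]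
  convert h2 using 1
  have h3 : 0 < √((matY Z).det)⁻¹ := Real.sqrt_pos.2 (inv_pos.2 hZ)
  have h4 : √((matY Z).det)⁻¹ ^ 2 = ((matY Z).det)⁻¹ := Real.sq_sqrt (inv_pos.2 hZ).le
  have h5 := hZ.ne'
  generalize √((matY Z).det)⁻¹ = s at *
  have h6 : s ^ 2 * (matY Z).det = 1 := by rw [h4, inv_mul_cancel₀ h5]
  field_simp
  linear_combination -(matH Z * D).trace * h6

lemma hasDerivAt_trace_matH_mul {Z : Matrix n n ℝ} (D K : Matrix n n ℝ) (hZ : IsUnit (matY Z)) :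
    HasDerivAt (fun t : ℝ => (matH (Z + t • D) * K).trace) (matHDiff Z D Z * K).trace 0 := by
  have hc : Tendsto (fun t : ℝ => Z + t • D) (𝓝 0) (𝓝 Z) := by
    have : Continuous fun t : ℝ => Z + t • D := by fun_prop
    simpa using this.tendsto 0
  have h1 := hasDerivAt_of_block (g := matH) (G := matH) (Z := Z) (D := D)
    (continuousAt_matH (isUnit_matY_block hZ hZ)) (by
      filter_upwards [hc.eventually (eventually_isUnit_matY hZ)] with t ht J X hX h
      refine matH_intertwine (isUnit_matY_block hZ ht) ?_ h
      rcases hX with rfl | rfl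
      · exact hZ
      · exact ht)
  simp only [trace, diag, Matrix.mul_apply]
  exact HasDerivAt.fun_sum fun i _ => HasDerivAt.fun_sum fun j _ => (h1 i j).mul_const _

lemma inv_matY_eq {Z : Matrix n n ℝ} (hZ : IsUnit (matY Z)) :
    (matY Z)⁻¹ = 1 + Z * ((1 / 2 : ℝ) • 1 + matH Z) := by
  have hu := (isUnit_iff_isUnit_det _).1 hZ
  have e1 : (1 + Z * ((1 / 2 : ℝ) • 1 + matH Z)) * matY Z = 1 := by
    have e2 : matH Z * matY Z = matDY Z + (1 / 2 : ℝ) • matY Z := by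
      rw [matH, Matrix.add_mul, Matrix.mul_assoc, nonsing_inv_mul _ hu, Matrix.mul_one,
        Matrix.smul_mul, Matrix.one_mul]
    have e3 : (1 + Z * ((1 / 2 : ℝ) • 1 + matH Z)) * matY Z =
        Z * matY Z + (Z * matDY Z + matY Z) := by
      rw [Matrix.add_mul, Matrix.one_mul, Matrix.mul_assoc, Matrix.add_mul, e2, Matrix.smul_mul,
        Matrix.one_mul, Matrix.mul_add, Matrix.mul_add, Matrix.mul_smul]
      module
    rw [e3, mul_matY, mul_matDY, sub_add_cancel]
  exact inv_eq_left_inv e1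

section Norm

attribute [local instance] Matrix.linftyOpNormedRing Matrix.linftyOpNormedAlgebra

lemma differentiableAt_comp_adSum_apply (C : n → n → n → ℝ) {g : Matrix n n ℝ → Matrix n n ℝ}
    {k : n → ℝ} (hg : ContDiffAt ℝ ⊤ g (adSum C k)) (i j : n) :
    DifferentiableAt ℝ (fun k => g (adSum C k) i j) k := by
  have h1 : DifferentiableAt ℝ (adSum C) k :=
    DifferentiableAt.fun_sum fun a _ => (differentiableAt_apply (𝕜 := ℝ) a k).smul_const _
  have h2 : DifferentiableAt ℝ (fun k => g (adSum C k)) k :=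
    (hg.differentiableAt (by simp)).comp k h1
  exact differentiableAt_pi.1 (differentiableAt_pi.1 h2 i) j

lemma differentiableAt_det_matY_adSum (C : n → n → n → ℝ) (k : n → ℝ) :
    DifferentiableAt ℝ (fun k => (matY (adSum C k)).det) k := by
  simp only [det_apply']
  refine DifferentiableAt.fun_sum fun σ _ => DifferentiableAt.const_mul ?_ _
  exact (HasFDerivAt.finsetProd fun i _ => (differentiableAt_comp_adSum_apply C
    (contDiff_matPowSum expBounded_matY).contDiffAt (σ i) i).hasFDerivAt).differentiableAt

lemma differentiableAt_trace_matH_adSum_mul (C : n → n → n → ℝ) {k : n → ℝ}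
    (hk : IsUnit (matY (adSum C k))) (K : Matrix n n ℝ) :
    DifferentiableAt ℝ (fun k => (matH (adSum C k) * K).trace) k := by
  simp only [trace, diag, Matrix.mul_apply]
  exact DifferentiableAt.fun_sum fun i _ => DifferentiableAt.fun_sum fun j _ =>
    (differentiableAt_comp_adSum_apply C (contDiffAt_matH hk) i j).mul_const _

end Norm

lemma adSum_add_smul (C : n → n → n → ℝ) (k w : n → ℝ) (t : ℝ) :
    adSum C (k + t • w) = adSum C k + t • adSum C w := by
  simp only [adSum, Pi.add_apply, Pi.smul_apply, smul_eq_mul, add_smul, Finset.sum_add_distrib,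
    Finset.smul_sum, smul_smul]

lemma adSum_single (C : n → n → n → ℝ) (a : n) : adSum C (Pi.single a 1) = adMat C a := by
  simp [adSum, Pi.single_apply]

lemma adSum_add (C : n → n → n → ℝ) (k w : n → ℝ) : adSum C (k + w) = adSum C k + adSum C w := by
  simpa using adSum_add_smul C k w 1

lemma trace_adSum (C : n → n → n → ℝ) (hC : ∀ a, (adMat C a).trace = 0) (w : n → ℝ) :
    (adSum C w).trace = 0 := by
  simp [adSum, trace_sum, hC]

lemma fderiv_apply_of_hasDerivAt {f : (n → ℝ) → ℝ} {k w : n → ℝ} {d : ℝ}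
    (hf : DifferentiableAt ℝ f k) (h : HasDerivAt (fun t : ℝ => f (k + t • w)) d 0) :
    fderiv ℝ f k w = d :=
  hf.lineDeriv_eq_fderiv.symm.trans (HasLineDerivAt.lineDeriv h)

lemma differentiableAt_sqrt_det (C : n → n → n → ℝ) {k : n → ℝ}
    (hk : 0 < (matY (adSum C k)).det) :
    DifferentiableAt ℝ (fun k => √((matY (adSum C k))⁻¹.det)) k := by
  simp only [det_nonsing_inv, Ring.inverse_eq_inv]
  exact ((differentiableAt_det_matY_adSum C k).fun_inv hk.ne').sqrt (inv_ne_zero hk.ne')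

lemma fderiv_trace_matH_mul (C : n → n → n → ℝ) {k : n → ℝ} (hk : IsUnit (matY (adSum C k)))
    (K : Matrix n n ℝ) (w : n → ℝ) :
    fderiv ℝ (fun k => (matH (adSum C k) * K).trace) k w =
      (matHDiff (adSum C k) (adSum C w) (adSum C k) * K).trace := by
  refine fderiv_apply_of_hasDerivAt (differentiableAt_trace_matH_adSum_mul C hk K) ?_
  simp only [adSum_add_smul]
  exact hasDerivAt_trace_matH_mul _ _ hk

lemma sum_sum_mul_eq_zero {g s : n → n → ℝ} (hg : ∀ a b, g a b = g b a)
    (hs : ∀ a b, s a b = -s b a) : ∑ a, ∑ b, g a b * s a b = 0 := by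
  have h : ∑ a, ∑ b, g a b * s a b = -∑ a, ∑ b, g a b * s a b := by
    conv_lhs => rw [Finset.sum_comm]
    rw [← Finset.sum_neg_distrib]
    refine Finset.sum_congr rfl fun a _ => ?_
    rw [← Finset.sum_neg_distrib]
    refine Finset.sum_congr rfl fun b _ => ?_
    rw [hg b a, hs b a]
    ring
  linarith

namespace IsQuadraticLie

variable {C : n → n → n → ℝ} {γ : Matrix n n ℝ}

lemma trace_adMat (h : IsQuadraticLie C γ) (a : n) : (adMat C a).trace = 0 := by
  have h1 := h.trace_eq_of_transpose_mul (M := adMat C a) (K := -adMat C a) (by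
    rw [h.transpose_adMat_mul, Matrix.mul_neg])
  rw [trace_neg] at h1
  linarith

lemma fderiv_sqrt_det (h : IsQuadraticLie C γ) {k : n → ℝ} (hk : 0 < (matY (adSum C k)).det)
    (w : n → ℝ) : fderiv ℝ (fun k => √((matY (adSum C k))⁻¹.det)) k w =
      -(1 / 2) * √((matY (adSum C k))⁻¹.det) * (matH (adSum C k) * adSum C w).trace := by
  refine fderiv_apply_of_hasDerivAt (differentiableAt_sqrt_det C hk) ?_
  simp only [adSum_add_smul]
  exact hasDerivAt_sqrt_det_matY hk (trace_adSum C h.trace_adMat w)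

/-- The columns of the inverse of `matY` at an adjoint matrix. -/
lemma col_inv_matY {k : n → ℝ} (hk : IsUnit (matY (adSum C k))) (a : n) :
    (fun b => (matY (adSum C k))⁻¹ b a) = Pi.single a 1 + adSum C k *ᵥ
      fun b => ((1 / 2 : ℝ) • (1 : Matrix n n ℝ) + matH (adSum C k)) b a := by
  ext b
  rw [inv_matY_eq hk, Matrix.add_apply, Pi.add_apply, one_apply, Pi.single_apply]
  rfl

lemma trace_matH_mul_adSum_mulVec (h : IsQuadraticLie C γ) {k : n → ℝ}
    (hk : IsUnit (matY (adSum C k))) (w : n → ℝ) :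
    (matH (adSum C k) * adSum C (adSum C k *ᵥ w)).trace = 0 := by
  have h1 : matH (adSum C k) * adSum C k = adSum C k * matH (adSum C k) :=
    matH_intertwine hk hk rfl
  rw [← h.adSum_commutator_adSum, Matrix.mul_sub, trace_sub, ← Matrix.mul_assoc, h1,
    ← Matrix.mul_assoc (matH _), Matrix.mul_assoc (adSum C k), trace_mul_comm (adSum C k), sub_self]

lemma trace_matH_mul_adSum_col (h : IsQuadraticLie C γ) {k : n → ℝ}
    (hk : IsUnit (matY (adSum C k))) (a : n) :
    (matH (adSum C k) * adSum C fun b => (matY (adSum C k))⁻¹ b a).trace =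
      (matH (adSum C k) * adMat C a).trace := by
  rw [col_inv_matY hk, adSum_add, adSum_single, Matrix.mul_add, trace_add,
    h.trace_matH_mul_adSum_mulVec hk, add_zero]

lemma trace_matHDiff_mulVec (h : IsQuadraticLie C γ) {k : n → ℝ}
    (hk : IsUnit (matY (adSum C k))) (w : n → ℝ) (b : n) :
    (matHDiff (adSum C k) (adSum C (adSum C k *ᵥ w)) (adSum C k) * adMat C b).trace =
      ∑ e, w e * ∑ d, C d e b * (matH (adSum C k) * adMat C d).trace := by
  rw [← h.adSum_commutator_adSum, matHDiff_lie hk]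
  have h1 : ((matH (adSum C k) * adSum C w - adSum C w * matH (adSum C k)) * adMat C b).trace =
      (matH (adSum C k) * (adSum C w * adMat C b - adMat C b * adSum C w)).trace := by
    rw [Matrix.sub_mul, Matrix.mul_sub, trace_sub, trace_sub, Matrix.mul_assoc, Matrix.mul_assoc,
      trace_mul_comm (adSum C w), Matrix.mul_assoc]
  have h2 : adSum C w * adMat C b - adMat C b * adSum C w =
      ∑ e, w e • ∑ d, C d e b • adMat C d := by
    simp only [← h.jacobi, adSum, Finset.sum_mul, Finset.mul_sum, Matrix.smul_mul, Matrix.mul_smul,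
      ← Finset.sum_sub_distrib, ← smul_sub]
  rw [h1, h2]
  simp only [Matrix.mul_sum, Matrix.mul_smul, trace_sum, trace_smul, smul_eq_mul]

lemma sum_fderiv_trace_matH_mul (h : IsQuadraticLie C γ) {k : n → ℝ}
    (hk : IsUnit (matY (adSum C k))) :
    ∑ a, ∑ b, γ⁻¹ a b * fderiv ℝ (fun k => (matH (adSum C k) * adMat C b).trace) k
        (fun c => (matY (adSum C k))⁻¹ c a) =
      (1 / 12) * ∑ a, ∑ b, γ⁻¹ a b * (adMat C a * adMat C b).trace +
      (1 / 2) * ∑ a, ∑ b, γ⁻¹ a b * ((matH (adSum C k) * adMat C a).trace *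
        (matH (adSum C k) * adMat C b).trace) := by
  let s : n → n → ℝ := fun a b => ∑ d, C d a b * (matH (adSum C k) * adMat C d).trace
  have e1 : ∀ a b, fderiv ℝ (fun k => (matH (adSum C k) * adMat C b).trace) k
      (fun c => (matY (adSum C k))⁻¹ c a) =
      (matHDiff (adSum C k) (adMat C a) (adSum C k) * adMat C b).trace +
        ((1 / 2) * s a b + ∑ e, matH (adSum C k) e a * s e b) := fun a b => by
    rw [col_inv_matY hk, map_add, fderiv_trace_matH_mul C hk, fderiv_trace_matH_mul C hk,
      adSum_single, h.trace_matHDiff_mulVec hk]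
    congr 1
    simp only [Matrix.add_apply, Matrix.smul_apply, one_apply, add_mul, Finset.sum_add_distrib]
    congr 1
    simp [s]
  have e2 : ∑ a, ∑ b, γ⁻¹ a b * s a b = 0 :=
    sum_sum_mul_eq_zero h.inv_symm fun a b => by
      simp only [s, ← Finset.sum_neg_distrib]
      exact Finset.sum_congr rfl fun d _ => by rw [h.antisymm d a b, neg_mul]
  have e3 : ∑ a, ∑ b, γ⁻¹ a b * ∑ e, matH (adSum C k) e a * s e b =
      ∑ a, ∑ b, γ⁻¹ a b * ((matH (adSum C k) * adMat C a).trace *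
        (matH (adSum C k) * adMat C b).trace) := by
    rw [← h.sum_mul_structure_mul_trace]
    change _ = ∑ e, ∑ b, (matH (adSum C k) * γ⁻¹) e b * s e b
    simp only [Matrix.mul_apply, Finset.mul_sum (s := Finset.univ), Finset.sum_mul]
    generalize s = s'
    rw [Finset.sum_comm_cycle]
    refine Finset.sum_congr rfl fun e _ => ?_
    rw [Finset.sum_comm]
    exact Finset.sum_congr rfl fun b _ => Finset.sum_congr rfl fun a _ => by ring
  have e4 := h.sum_matHDiff_self k hk
  simp only [e1, mul_add, Finset.sum_add_distrib]
  rw [e4, e3]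
  have e5 : ∑ a, ∑ b, γ⁻¹ a b * (1 / 2 * s a b) = (1 / 2) * ∑ a, ∑ b, γ⁻¹ a b * s a b := by
    simp only [Finset.mul_sum]
    exact Finset.sum_congr rfl fun a _ => Finset.sum_congr rfl fun b _ => by ring
  rw [e5, e2]
  ring

end IsQuadraticLie

namespace IsQuadraticLie

variable {C : n → n → n → ℝ} {γ : Matrix n n ℝ}

lemma fderiv_sqrt_det_col (h : IsQuadraticLie C γ) {k : n → ℝ} (hk : 0 < (matY (adSum C k)).det)
    (b : n) : fderiv ℝ (fun k => √((matY (adSum C k))⁻¹.det)) k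
        (fun c => (matY (adSum C k))⁻¹ c b) =
      -(1 / 2) * (√((matY (adSum C k))⁻¹.det) * (matH (adSum C k) * adMat C b).trace) := by
  have hu : IsUnit (matY (adSum C k)) := (isUnit_iff_isUnit_det _).2 hk.ne'.isUnit
  rw [h.fderiv_sqrt_det hk, h.trace_matH_mul_adSum_col hu, mul_assoc]

lemma sum_fderiv_fderiv_sqrt_det (h : IsQuadraticLie C γ) {k : n → ℝ}
    (hk : 0 < (matY (adSum C k)).det) :
    ∑ a, ∑ b, γ⁻¹ a b * fderiv ℝ (fun k => fderiv ℝ (fun k => √((matY (adSum C k))⁻¹.det)) k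
        (fun c => (matY (adSum C k))⁻¹ c b)) k (fun c => (matY (adSum C k))⁻¹ c a) =
      √((matY (adSum C k))⁻¹.det) *
        (-(1 / 24) * ∑ a, ∑ b, γ⁻¹ a b * (adMat C a * adMat C b).trace) := by
  have hu : IsUnit (matY (adSum C k)) := (isUnit_iff_isUnit_det _).2 hk.ne'.isUnit
  have hev : ∀ᶠ k' in 𝓝 k, 0 < (matY (adSum C k')).det :=
    (differentiableAt_det_matY_adSum C k).continuousAt.eventually_const_lt hk
  have e1 : ∀ a b, fderiv ℝ (fun k => fderiv ℝ (fun k => √((matY (adSum C k))⁻¹.det)) k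
      (fun c => (matY (adSum C k))⁻¹ c b)) k (fun c => (matY (adSum C k))⁻¹ c a) =
      √((matY (adSum C k))⁻¹.det) *
        ((1 / 4) * ((matH (adSum C k) * adMat C a).trace * (matH (adSum C k) * adMat C b).trace) -
        (1 / 2) * fderiv ℝ (fun k => (matH (adSum C k) * adMat C b).trace) k
          (fun c => (matY (adSum C k))⁻¹ c a)) := fun a b => by
    have e2 : (fun k => fderiv ℝ (fun k => √((matY (adSum C k))⁻¹.det)) k
        (fun c => (matY (adSum C k))⁻¹ c b)) =ᶠ[𝓝 k] fun k =>
        -(1 / 2) * (√((matY (adSum C k))⁻¹.det) * (matH (adSum C k) * adMat C b).trace) := by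
      filter_upwards [hev] with k' hk'
      exact h.fderiv_sqrt_det_col hk' b
    have d1 := differentiableAt_sqrt_det C hk
    have d2 := differentiableAt_trace_matH_adSum_mul C hu (adMat C b)
    have e3 := h.fderiv_sqrt_det_col hk a
    rw [e2.fderiv_eq, fderiv_const_mul (d1.fun_mul d2), fderiv_fun_mul d1 d2]
    simp only [_root_.smul_apply, _root_.add_apply, smul_eq_mul, e3]
    ring
  have e4 := h.sum_fderiv_trace_matH_mul hu
  simp only [e1]
  generalize √((matY (adSum C k))⁻¹.det) = s
  have e5 : ∀ u v : n → n → ℝ, ∑ a, ∑ b, γ⁻¹ a b * (s * ((1 / 4) * u a b - (1 / 2) * v a b)) =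
      s * ((1 / 4) * ∑ a, ∑ b, γ⁻¹ a b * u a b - (1 / 2) * ∑ a, ∑ b, γ⁻¹ a b * v a b) :=
      fun u v => by
    simp only [Finset.mul_sum, ← Finset.sum_sub_distrib]
    exact Finset.sum_congr rfl fun a _ => Finset.sum_congr rfl fun b _ => by ring
  rw [e5 (fun a b => _) (fun a b => _), e4]
  ring

end IsQuadraticLie

end PowerSeries

lemma vecFieldOp_eq_fderiv {N : ℕ} (Xe : (Fin N → ℝ) → Fin N → Fin N → ℝ) (A : Fin N)
    (f : (Fin N → ℝ) → ℝ) (k : Fin N → ℝ) : vecFieldOp Xe A f k = fderiv ℝ f k (Xe k A) := by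
  conv_rhs => rw [← Finset.univ_sum_single (Xe k A), map_sum]
  refine Finset.sum_congr rfl fun M _ => ?_
  rw [← smul_eq_mul, ← map_smul, ← Pi.single_smul, smul_eq_mul, mul_one]

/-- `(det X)^{-1/2} γ^{AB} X_A X_B (det X)^{1/2} = -(1/24) γ^{AB} C^C_{AD} C^D_{BC}`
on the connected component of `0` of `{k : Y(k) invertible and det Y(k) > 0}`. -/
theorem casimir_on_sqrt_detX
    (N : ℕ)
    (C : Fin N → Fin N → Fin N → ℝ)
    (hCanti : ∀ A B C', C A B C' = -C A C' B)
    (CM : Fin N → Matrix (Fin N) (Fin N) ℝ)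
    (hCM : ∀ A B C', CM A B C' = C B A C')
    (hCC : ∀ A B, CM A * CM B - CM B * CM A = ∑ C', C C' A B • CM C')
    (γ : Matrix (Fin N) (Fin N) ℝ)
    (hγsymm : γᵀ = γ) (hγinv : IsUnit γ)
    (hγC : ∀ A C' D', ∑ B, (γ A B * C B C' D' + γ D' B * C B C' A) = 0)
    (Y : (Fin N → ℝ) → Matrix (Fin N) (Fin N) ℝ)
    (hY : ∀ k, Y k =
      ∑' j : ℕ, ((-1 : ℝ) ^ j / (Nat.factorial (j + 1))) • (∑ A, k A • CM A) ^ j)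
    (V : Set (Fin N → ℝ))
    (hV : V = connectedComponentIn {k | IsUnit (Y k) ∧ 0 < (Y k).det} 0)
    (Xe : (Fin N → ℝ) → Fin N → Fin N → ℝ)
    (hXe : ∀ k A M, Xe k A M = (Y k)⁻¹ M A) :
    ∀ k ∈ V,
      (Real.sqrt (((Y k)⁻¹).det))⁻¹ *
        ∑ A, ∑ B, γ⁻¹ A B *
          vecFieldOp Xe A (fun k' => vecFieldOp Xe B (fun k'' => Real.sqrt (((Y k'')⁻¹).det)) k') k
      = -(1/24 : ℝ) * ∑ A, ∑ B, ∑ C', ∑ D', γ⁻¹ A B * C C' A D' * C D' B C' := by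
  intro k hk
  obtain rfl : CM = adMat C := by
    ext A B C'
    exact hCM A B C'
  have h : IsQuadraticLie C γ := ⟨hCanti, hCC, hγsymm, hγinv, hγC⟩
  have hYm : ∀ k, Y k = matY (adSum C k) := hY
  rw [hV] at hk
  have hpos : 0 < (Y k).det := (connectedComponentIn_subset _ _ hk).2
  have hX : ∀ k A, Xe k A = fun M => (matY (adSum C k))⁻¹ M A := fun k A => by
    ext M
    rw [hXe, hYm]
  rw [hYm] at hpos
  simp only [vecFieldOp_eq_fderiv, hX, hYm]
  have hdet : 0 < (matY (adSum C k))⁻¹.det := by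
    rw [det_nonsing_inv, Ring.inverse_eq_inv]
    exact inv_pos.2 hpos
  rw [h.sum_fderiv_fderiv_sqrt_det hpos, inv_mul_cancel_left₀ (Real.sqrt_pos.2 hdet).ne']
  congr 1
  refine Finset.sum_congr rfl fun A _ => Finset.sum_congr rfl fun B _ => ?_
  simp only [trace, diag, Matrix.mul_apply, Finset.mul_sum, mul_assoc]
  rfl
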